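/- arXiv:1911.04375 — 4 statements merged into one kernel-verified Lean document; each statement's English description precedes it below -/
import Mathlib

section
/- Let A⊆R⁺ (respectively A⊆R⁻) be a Borel set of positive Lebesgue measure. Then there exists a constant 0<c_A<1 such that for every n≥1 and every Markov n-tile W of T with T^n(W)=R⁺ (respectively T^n(W)=R⁻), one has Leb(W∩T^{−n}(A))/Leb(W) ≥ c_A. -/
noncomputable section

open Set Filter MeasureTheory Topology

/-- The Gauss map `G(ρ) = {1/ρ}`, `G(0) = 0`. -/
def gaussMap (ρ : ℝ) : ℝ := if ρ = 0 then 0 else Int.fract (1 / ρ)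

/-- The fiber maps `T_ρ : [-1,1] → [-1,1]` of the skew product. -/
def fiberMap (ρ α : ℝ) : ℝ :=
  if ρ = 0 then 0
  else if α ≤ 0 then -α
  else if α ≤ ρ * gaussMap ρ then -α / (ρ * gaussMap ρ)
  else Int.fract ((1 - α) / ρ)

/-- The skew product `T(ρ,α) = (G(ρ), T_ρ(α))`. -/
def skewProd (p : ℝ × ℝ) : ℝ × ℝ := (gaussMap p.1, fiberMap p.1 p.2)

/-- The rectangle `R = [0,1] × [-1,1]`. -/
def Rect : Set (ℝ × ℝ) := Icc (0 : ℝ) 1 ×ˢ Icc (-1 : ℝ) 1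

/-- `M = ([0,1] ∖ ℚ) × [-1,1]`. -/
def Mset : Set (ℝ × ℝ) := {p | p ∈ Rect ∧ Irrational p.1}

/-- The `n`-th partial quotient of the continued fraction expansion of `θ`:
`a_n(θ) = ⌊1 / Gⁿ(θ)⌋`. -/
def pquot (θ : ℝ) (n : ℕ) : ℕ := ⌊1 / gaussMap^[n] θ⌋₊

/-- The set `𝔼_∞` of irrational numbers in `(0,1)` all of whose partial quotients are even
and tend to infinity. -/
def Einf : Set ℝ :=
  {θ | θ ∈ Ioo (0 : ℝ) 1 ∧ Irrational θ ∧ (∀ n, Even (pquot θ n)) ∧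
    Tendsto (fun n => pquot θ n) atTop atTop}

/-- `R⁺ = (0,1) × (0,1)`. -/
def Rplus : Set (ℝ × ℝ) := Ioo (0 : ℝ) 1 ×ˢ Ioo (0 : ℝ) 1

/-- `R⁻ = (0,1) × (-1,0)`. -/
def Rminus : Set (ℝ × ℝ) := Ioo (0 : ℝ) 1 ×ˢ Ioo (-1 : ℝ) 0

/-- The trapezoid atoms `V_{k,ℓ}` of the Markov partition. -/
def atomV (k l : ℕ) : Set (ℝ × ℝ) :=
  {p | 1 / ((k : ℝ) + 1) < p.1 ∧ p.1 < 1 / (k : ℝ) ∧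
    1 - ((l : ℝ) + 1) * p.1 < p.2 ∧ p.2 < 1 - (l : ℝ) * p.1}

/-- The triangle atoms `U_k` of the Markov partition. -/
def atomU (k : ℕ) : Set (ℝ × ℝ) :=
  {p | 1 / ((k : ℝ) + 1) < p.1 ∧ p.1 < 1 / (k : ℝ) ∧ 0 < p.2 ∧ p.2 < 1 - (k : ℝ) * p.1}

/-- The rectangle atoms `R_k` of the Markov partition. -/
def atomR (k : ℕ) : Set (ℝ × ℝ) :=
  {p | 1 / ((k : ℝ) + 1) < p.1 ∧ p.1 < 1 / (k : ℝ) ∧ -1 < p.2 ∧ p.2 < 0}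

/-- The atoms of the Markov partition for `T`. -/
def markovAtoms : Set (Set (ℝ × ℝ)) :=
  {A | (∃ k : ℕ, 1 ≤ k ∧ A = atomU k) ∨ (∃ k : ℕ, 1 ≤ k ∧ A = atomR k) ∨
    (∃ k l : ℕ, 1 ≤ k ∧ l < k ∧ A = atomV k l)}

/-- A Markov `n`-tile: an open subset `W ⊆ R` such that each image `T^j(W)` (`j < n`) lies in a
single Markov atom, and `T^n` maps `W` bijectively onto `R⁺` or onto `R⁻`. -/
def IsMarkovTile (n : ℕ) (W : Set (ℝ × ℝ)) : Prop :=
  IsOpen W ∧ W ⊆ Rect ∧ (∀ j < n, ∃ A ∈ markovAtoms, skewProd^[j] '' W ⊆ A) ∧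
    (Set.BijOn skewProd^[n] W Rplus ∨ Set.BijOn skewProd^[n] W Rminus)

/-- `φ` is differentiable at `z` with absolute Jacobian determinant `J`. -/
def HasAbsJacobianAt (φ : ℝ × ℝ → ℝ × ℝ) (J : ℝ) (z : ℝ × ℝ) : Prop :=
  ∃ D : ℝ × ℝ →L[ℝ] ℝ × ℝ, HasFDerivAt φ D z ∧ |D.det| = J

lemma HasAbsJacobianAt.comp {ψ φ : ℝ × ℝ → ℝ × ℝ} {J K : ℝ} {z : ℝ × ℝ}
    (hψ : HasAbsJacobianAt ψ J (φ z)) (hφ : HasAbsJacobianAt φ K z) :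
    HasAbsJacobianAt (ψ ∘ φ) (J * K) z := by
  obtain ⟨D, hD, rfl⟩ := hψ
  obtain ⟨E, hE, rfl⟩ := hφ
  refine ⟨_, hD.comp z hE, ?_⟩
  rw [← abs_mul, ContinuousLinearMap.det, ContinuousLinearMap.det, ContinuousLinearMap.det,
    ContinuousLinearMap.toLinearMap_comp, LinearMap.det_comp]

/-- A map `(x, y) ↦ (r x, u x + v x * y)` has a lower triangular derivative. -/
lemma exists_hasFDerivAt_triangular {r u v : ℝ → ℝ} {r' u' v' : ℝ} {p : ℝ × ℝ}
    (hr : HasDerivAt r r' p.1) (hu : HasDerivAt u u' p.1) (hv : HasDerivAt v v' p.1) :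
    ∃ D : ℝ × ℝ →L[ℝ] ℝ × ℝ,
      HasFDerivAt (fun z : ℝ × ℝ => (r z.1, u z.1 + v z.1 * z.2)) D p ∧
        D.det = r' * v p.1 := by
  have h1 : HasFDerivAt (fun z : ℝ × ℝ => z.1) (ContinuousLinearMap.fst ℝ ℝ ℝ) p :=
    hasFDerivAt_fst
  have h2 : HasFDerivAt (fun z : ℝ × ℝ => z.2) (ContinuousLinearMap.snd ℝ ℝ ℝ) p :=
    hasFDerivAt_snd
  refine ⟨_, (hr.comp_hasFDerivAt p h1).prodMk
    ((hu.comp_hasFDerivAt p h1).add ((hv.comp_hasFDerivAt p h1).mul h2)), ?_⟩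
  rw [ContinuousLinearMap.det, ← LinearMap.det_toMatrix (Module.Basis.finTwoProd ℝ),
    Matrix.det_fin_two]
  simp [LinearMap.toMatrix_apply]

lemma hasDerivAt_one_div_add {x k : ℝ} (h : x + k ≠ 0) :
    HasDerivAt (fun t : ℝ => 1 / (t + k)) (-1 / (x + k) ^ 2) x := by
  simpa using ((hasDerivAt_id' x).add_const k).fun_inv h

lemma gaussMap_eq_of_mem {k : ℕ} (hk : 1 ≤ k) {ρ : ℝ} (h1 : 1 / ((k : ℝ) + 1) < ρ)
    (h2 : ρ < 1 / (k : ℝ)) :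
    0 < ρ ∧ ρ < 1 ∧ (k : ℝ) * ρ < 1 ∧ 1 < ((k : ℝ) + 1) * ρ ∧ gaussMap ρ = 1 / ρ - k := by
  have hk' : (1 : ℝ) ≤ k := by exact_mod_cast hk
  have h0 : 0 < ρ := lt_trans (by positivity) h1
  rw [div_lt_iff₀ (by positivity)] at h1
  rw [lt_div_iff₀ (by positivity)] at h2
  refine ⟨h0, by nlinarith, by linarith, by linarith, ?_⟩
  rw [gaussMap, if_neg h0.ne', Int.fract, sub_right_inj]
  have : ⌊1 / ρ⌋ = (k : ℤ) := by
    rw [Int.floor_eq_iff]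
    push_cast
    rw [le_div_iff₀ h0, div_lt_iff₀ h0]
    constructor <;> linarith
  rw [this]; simp

lemma skewProd_of_mem_atomR {k : ℕ} (hk : 1 ≤ k) {w : ℝ × ℝ} (hw : w ∈ atomR k) :
    skewProd w = (1 / w.1 - k, -w.2) := by
  obtain ⟨h1, h2, h3, h4⟩ := hw
  obtain ⟨h0, -, -, -, hG⟩ := gaussMap_eq_of_mem hk h1 h2
  simp only [skewProd, fiberMap, hG, if_neg h0.ne', if_pos h4.le]

lemma skewProd_of_mem_atomU {k : ℕ} (hk : 1 ≤ k) {w : ℝ × ℝ} (hw : w ∈ atomU k) :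
    skewProd w = (1 / w.1 - k, -w.2 / (1 - k * w.1)) := by
  obtain ⟨h1, h2, h3, h4⟩ := hw
  obtain ⟨h0, -, -, -, hG⟩ := gaussMap_eq_of_mem hk h1 h2
  have h : w.1 * (1 / w.1 - k) = 1 - k * w.1 := by field_simp
  simp only [skewProd, fiberMap, hG, h, if_neg h0.ne', if_neg h3.not_ge, if_pos h4.le]

lemma skewProd_of_mem_atomV {k l : ℕ} (hk : 1 ≤ k) (hl : l < k) {w : ℝ × ℝ}
    (hw : w ∈ atomV k l) :
    skewProd w = (1 / w.1 - k, (1 - w.2) / w.1 - l) := by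
  obtain ⟨h1, h2, h3, h4⟩ := hw
  obtain ⟨h0, -, h5, -, hG⟩ := gaussMap_eq_of_mem hk h1 h2
  have h : w.1 * (1 / w.1 - k) = 1 - k * w.1 := by field_simp
  have hl' : (l : ℝ) + 1 ≤ k := by exact_mod_cast hl
  have h6 : 1 - k * w.1 < w.2 := by nlinarith
  have hfl : ⌊(1 - w.2) / w.1⌋ = (l : ℤ) := by
    rw [Int.floor_eq_iff]
    push_cast
    rw [le_div_iff₀ h0, div_lt_iff₀ h0]
    constructor <;> linarith
  simp only [skewProd, fiberMap, hG, h, if_neg h0.ne', if_neg h6.not_ge,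
    if_neg (show ¬ w.2 ≤ 0 by linarith), Int.fract, hfl, Int.cast_natCast]

/-- The inverse branch of `skewProd` on an atom, with the modulus of its Jacobian. -/
lemma exists_inverse_branch {a : Set (ℝ × ℝ)} (ha : a ∈ markovAtoms) :
    ∃ k : ℕ, 1 ≤ k ∧ ∃ ψ : ℝ × ℝ → ℝ × ℝ,
      (∀ w ∈ a, ψ (skewProd w) = w ∧ w.1 = 1 / ((skewProd w).1 + k)) ∧
      (((∀ w ∈ a, w ∈ Rplus ∧ skewProd w ∈ Rplus ∧
          HasAbsJacobianAt ψ (1 / ((skewProd w).1 + k) ^ 3) (skewProd w))) ∨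
       ((∀ w ∈ a, w ∈ Rminus ∧ skewProd w ∈ Rplus ∧
          HasAbsJacobianAt ψ (1 / ((skewProd w).1 + k) ^ 2) (skewProd w))) ∨
       ((∀ w ∈ a, w ∈ Rplus ∧ skewProd w ∈ Rminus ∧
          HasAbsJacobianAt ψ ((skewProd w).1 / ((skewProd w).1 + k) ^ 3) (skewProd w)))) := by
  rcases ha with ⟨k, hk, rfl⟩ | ⟨k, hk, rfl⟩ | ⟨k, l, hk, hl, rfl⟩
  · refine ⟨k, hk, fun z => (1 / (z.1 + k), 0 + -(z.1 * (1 / (z.1 + k))) * z.2),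
      fun w hw => ?_, Or.inr (Or.inr fun w hw => ?_)⟩
    · obtain ⟨h1, h2, h3, h4⟩ := id hw
      obtain ⟨h0, -, h5, h6, -⟩ := gaussMap_eq_of_mem hk h1 h2
      have h7 : 1 - w.1 * (k : ℝ) ≠ 0 := by linarith
      rw [skewProd_of_mem_atomU hk hw]
      refine ⟨Prod.ext ?_ ?_, ?_⟩ <;> simp
      field_simp
    · obtain ⟨h1, h2, h3, h4⟩ := id hw
      obtain ⟨h0, h8, h5, h6, -⟩ := gaussMap_eq_of_mem hk h1 h2
      have h7 : 0 < 1 - (k : ℝ) * w.1 := by linarith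
      have hx : 0 < 1 / w.1 - k := by rw [sub_pos, lt_div_iff₀ h0]; linarith
      have hx1 : 1 / w.1 - k < 1 := by rw [sub_lt_iff_lt_add, div_lt_iff₀ h0]; linarith
      have hxk : 0 < 1 / w.1 - k + k := by positivity
      rw [skewProd_of_mem_atomU hk hw]
      refine ⟨⟨⟨h0, h8⟩, h3, ?_⟩, ⟨⟨hx, hx1⟩, ?_, ?_⟩, ?_⟩
      · have : 0 < (k : ℝ) * w.1 := by positivity
        linarith
      · rw [lt_div_iff₀ h7]; linarith
      · exact div_neg_of_neg_of_pos (by linarith) h7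
      · have hr := hasDerivAt_one_div_add hxk.ne'
        obtain ⟨D, hD, hdet⟩ := exists_hasFDerivAt_triangular
          (p := (1 / w.1 - k, -w.2 / (1 - k * w.1))) hr (hasDerivAt_const _ 0)
          (((hasDerivAt_id _).mul hr).neg)
        refine ⟨D, hD, ?_⟩
        rw [hdet]
        simp only [id, Pi.neg_apply, Pi.mul_apply]
        rw [abs_mul, abs_div, abs_neg, abs_neg, abs_mul, abs_one, abs_div, abs_one, abs_pow,
          abs_of_pos hxk, abs_of_pos hx]
        field_simp
  · refine ⟨k, hk, fun z => (1 / (z.1 + k), 0 + (-1) * z.2),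
      fun w hw => ?_, Or.inr (Or.inl fun w hw => ?_)⟩
    · rw [skewProd_of_mem_atomR hk hw]
      refine ⟨Prod.ext ?_ ?_, ?_⟩ <;> simp
    · obtain ⟨h1, h2, h3, h4⟩ := id hw
      obtain ⟨h0, h8, h5, h6, -⟩ := gaussMap_eq_of_mem hk h1 h2
      have hx : 0 < 1 / w.1 - k := by rw [sub_pos, lt_div_iff₀ h0]; linarith
      have hx1 : 1 / w.1 - k < 1 := by rw [sub_lt_iff_lt_add, div_lt_iff₀ h0]; linarith
      have hxk : 0 < 1 / w.1 - k + k := by positivity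
      rw [skewProd_of_mem_atomR hk hw]
      refine ⟨⟨⟨h0, h8⟩, h3, h4⟩, ⟨⟨hx, hx1⟩, neg_pos.2 h4, by linarith⟩, ?_⟩
      obtain ⟨D, hD, hdet⟩ := exists_hasFDerivAt_triangular
        (p := (1 / w.1 - k, -w.2)) (hasDerivAt_one_div_add hxk.ne') (hasDerivAt_const _ 0)
        (hasDerivAt_const _ (-1))
      refine ⟨D, hD, ?_⟩
      rw [hdet, abs_mul, abs_div, abs_neg, abs_one, abs_pow, abs_of_pos hxk, mul_one]
  · refine ⟨k, hk, fun z => (1 / (z.1 + k), (1 - l * (1 / (z.1 + k))) + -(1 / (z.1 + k)) * z.2),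
      fun w hw => ?_, Or.inl fun w hw => ?_⟩
    · obtain ⟨h1, h2, h3, h4⟩ := id hw
      obtain ⟨h0, -, -, -, -⟩ := gaussMap_eq_of_mem hk h1 h2
      rw [skewProd_of_mem_atomV hk hl hw]
      refine ⟨Prod.ext ?_ ?_, ?_⟩ <;> simp
      field_simp
      ring
    · obtain ⟨h1, h2, h3, h4⟩ := id hw
      obtain ⟨h0, h8, h5, h6, -⟩ := gaussMap_eq_of_mem hk h1 h2
      have hl' : (l : ℝ) + 1 ≤ k := by exact_mod_cast hl
      have hx : 0 < 1 / w.1 - k := by rw [sub_pos, lt_div_iff₀ h0]; linarith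
      have hx1 : 1 / w.1 - k < 1 := by rw [sub_lt_iff_lt_add, div_lt_iff₀ h0]; linarith
      have hxk : 0 < 1 / w.1 - k + k := by positivity
      rw [skewProd_of_mem_atomV hk hl hw]
      refine ⟨⟨⟨h0, h8⟩, by nlinarith, ?_⟩, ⟨⟨hx, hx1⟩, ?_, ?_⟩, ?_⟩
      · have : 0 ≤ (l : ℝ) * w.1 := by positivity
        linarith
      · rw [sub_pos, lt_div_iff₀ h0]; linarith
      · rw [sub_lt_iff_lt_add, div_lt_iff₀ h0]; linarith
      · have hr := hasDerivAt_one_div_add hxk.ne'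
        obtain ⟨D, hD, hdet⟩ := exists_hasFDerivAt_triangular
          (p := (1 / w.1 - k, (1 - w.2) / w.1 - l)) hr
          ((hr.const_mul (l : ℝ)).const_sub 1) hr.neg
        refine ⟨D, hD, ?_⟩
        rw [hdet]
        simp only [Pi.neg_apply]
        rw [abs_mul, abs_div, abs_neg, abs_neg, abs_one, abs_div, abs_one, abs_pow,
          abs_of_pos hxk]
        field_simp

/-- The inverse branch of `skewProd^[n]` on a tile: its first coordinate is a Möbius map, and its
Jacobian is a weight depending only on the image, over a product of three linear forms. -/
lemma exists_tile_inverse {S : Set (ℝ × ℝ)} {ω : ℝ × ℝ → ℝ}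
    (hS : (S = Rplus ∧ ω = fun _ => 1) ∨ (S = Rminus ∧ ω = Prod.fst)) (n : ℕ) :
    ∀ W : Set (ℝ × ℝ), (∀ j < n, ∃ A ∈ markovAtoms, skewProd^[j] '' W ⊆ A) →
      Set.BijOn skewProd^[n] W S →
      ∃ (φ : ℝ × ℝ → ℝ × ℝ) (p p' q q' : ℝ), 0 ≤ p ∧ 0 ≤ p' ∧ 0 ≤ q ∧ q ≤ q' ∧ 0 < q' ∧
        p + q ≤ p' + q' ∧ (1 ≤ n → p ≤ p' ∧ 0 < p') ∧
        (∀ z ∈ S, φ z ∈ W ∧ skewProd^[n] (φ z) = z ∧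
          (φ z).1 = (p * z.1 + p') / (q * z.1 + q')) ∧
        ((∀ z ∈ S, φ z ∈ Rplus ∧ HasAbsJacobianAt φ (ω z / (q * z.1 + q') ^ 3) z) ∨
         (∀ z ∈ S, φ z ∈ Rminus ∧
          HasAbsJacobianAt φ (ω z / ((q * z.1 + q') ^ 2 * (p * z.1 + p'))) z)) := by
  have hx : ∀ z ∈ S, 0 < z.1 := by
    rintro z hz
    rcases hS with ⟨rfl, -⟩ | ⟨rfl, -⟩ <;> exact hz.1.1
  induction n with
  | zero =>
    intro W _ hbij
    have hWS : W = S := by simpa using hbij.image_eq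
    subst hWS
    have hid : ∀ z, HasAbsJacobianAt id 1 z := fun z =>
      ⟨_, hasFDerivAt_id z, by simp [ContinuousLinearMap.det]⟩
    refine ⟨id, 1, 0, 0, 1, by simp, by simp, by simp, by simp, by simp, by simp, by simp,
      fun z hz => ⟨hz, by simp⟩, ?_⟩
    rcases hS with ⟨rfl, rfl⟩ | ⟨rfl, rfl⟩
    · exact Or.inl fun z hz => ⟨hz, by simpa using hid z⟩
    · exact Or.inr fun z hz => ⟨hz, by simpa [div_self (hx z hz).ne'] using hid z⟩
  | succ n ih =>
    intro W hW hbij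
    obtain ⟨φ, p, p', q, q', hp, hp', hq, hqq, hq', hpq, -, hφ, hJ⟩ := ih (skewProd '' W)
      (fun j hj => by
        obtain ⟨A, hA, hWA⟩ := hW (j + 1) (by omega)
        refine ⟨A, hA, ?_⟩
        rwa [← image_comp, ← Function.iterate_succ])
      ⟨by
        rintro _ ⟨w, hw, rfl⟩
        exact hbij.mapsTo hw, by
        rintro _ ⟨w, hw, rfl⟩ _ ⟨w', hw', rfl⟩ h
        rw [hbij.injOn hw hw' h], by
        intro z hz
        obtain ⟨w, hw, rfl⟩ := hbij.surjOn hz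
        exact ⟨skewProd w, mem_image_of_mem _ hw, rfl⟩⟩
    obtain ⟨a, ha, hWa⟩ := hW 0 (by omega)
    rw [Function.iterate_zero, image_id] at hWa
    obtain ⟨k, hk, ψ, hψ, hcase⟩ := exists_inverse_branch ha
    have hk1 : (1 : ℝ) ≤ k := by exact_mod_cast hk
    have hlift : ∀ z ∈ S, ∃ w ∈ W, skewProd w = φ z ∧ ψ (φ z) = w := by
      intro z hz
      obtain ⟨w, hw, hwz⟩ := (hφ z hz).1
      exact ⟨w, hw, hwz, by rw [← hwz]; exact (hψ w (hWa hw)).1⟩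
    have hQ : ∀ z ∈ S, 0 < q * z.1 + q' := fun z hz => by
      have := mul_nonneg hq (hx z hz).le
      linarith
    have hP : ∀ z ∈ S, 0 ≤ p * z.1 + p' := fun z hz => by
      have := mul_nonneg hp (hx z hz).le
      linarith
    have hQk : ∀ z ∈ S, 0 < (p + k * q) * z.1 + (p' + k * q') := fun z hz => by
      have h1 := hP z hz
      have h2 := mul_pos (zero_lt_one.trans_le hk1) (hQ z hz)
      linarith
    have hden : ∀ z ∈ S, (φ z).1 + k =
        ((p + k * q) * z.1 + (p' + k * q')) / (q * z.1 + q') := fun z hz => by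
      rw [(hφ z hz).2.2, div_add' _ _ _ (hQ z hz).ne']
      congr 1
      ring
    refine ⟨ψ ∘ φ, q, q', p + k * q, p' + k * q', hq, hq'.le, by positivity, ?_, by positivity,
      ?_, fun _ => ⟨hqq, hq'⟩, fun z hz => ?_, ?_⟩
    · nlinarith
    · nlinarith
    · obtain ⟨w, hw, hwz, hψw⟩ := hlift z hz
      rw [Function.comp_apply, hψw]
      refine ⟨hw, ?_, ?_⟩
      · rw [Function.iterate_succ_apply, hwz, (hφ z hz).2.1]
      · rw [(hψ w (hWa hw)).2, hwz, hden z hz, one_div_div]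
    · rcases hcase with hc | hc | hc
      · rcases hJ with hJ | hJ
        · refine Or.inl fun z hz => ?_
          obtain ⟨w, hw, hwz, hψw⟩ := hlift z hz
          obtain ⟨h1, h2, h3⟩ := hc w (hWa hw)
          rw [hwz, hden z hz] at h3
          refine ⟨by rwa [Function.comp_apply, hψw], ?_⟩
          convert h3.comp (hJ z hz).2 using 1
          have := hQ z hz
          have := hQk z hz
          field_simp
        · refine Or.inl fun z hz => ?_
          obtain ⟨w, hw, hwz, hψw⟩ := hlift z hz
          obtain ⟨h1, h2, h3⟩ := hc w (hWa hw)
          rw [hwz] at h2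
          exact absurd h2.2.1 (hJ z hz).1.2.2.not_gt
      · rcases hJ with hJ | hJ
        · refine Or.inr fun z hz => ?_
          obtain ⟨w, hw, hwz, hψw⟩ := hlift z hz
          obtain ⟨h1, h2, h3⟩ := hc w (hWa hw)
          rw [hwz, hden z hz] at h3
          refine ⟨by rwa [Function.comp_apply, hψw], ?_⟩
          convert h3.comp (hJ z hz).2 using 1
          have := hQ z hz
          have := hQk z hz
          field_simp
        · refine Or.inr fun z hz => ?_
          obtain ⟨w, hw, hwz, hψw⟩ := hlift z hz
          obtain ⟨h1, h2, h3⟩ := hc w (hWa hw)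
          rw [hwz] at h2
          exact absurd h2.2.1 (hJ z hz).1.2.2.not_gt
      · rcases hJ with hJ | hJ
        · refine Or.inl fun z hz => ?_
          obtain ⟨w, hw, hwz, hψw⟩ := hlift z hz
          obtain ⟨h1, h2, h3⟩ := hc w (hWa hw)
          rw [hwz] at h2
          exact absurd h2.2.2 (hJ z hz).1.2.1.not_gt
        · refine Or.inl fun z hz => ?_
          obtain ⟨w, hw, hwz, hψw⟩ := hlift z hz
          obtain ⟨h1, h2, h3⟩ := hc w (hWa hw)
          rw [hwz, hden z hz, (hφ z hz).2.2] at h3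
          refine ⟨by rwa [Function.comp_apply, hψw], ?_⟩
          convert h3.comp (hJ z hz).2 using 1
          have h4 := hQ z hz
          have h5 := hQk z hz
          have h6 : 0 < p * z.1 + p' := by
            have := (hJ z hz).1.1.1
            rw [(hφ z hz).2.2] at this
            exact (div_pos_iff_of_pos_right h4).1 this
          field_simp

/-- Bounded distortion: the Jacobian of the inverse branch is the weight `ω`, up to a constant
and a factor in `[1/8, 1]`. -/
lemma exists_tile_inverse_bounded {S : Set (ℝ × ℝ)} {ω : ℝ × ℝ → ℝ}
    (hS : (S = Rplus ∧ ω = fun _ => 1) ∨ (S = Rminus ∧ ω = Prod.fst)) {n : ℕ} (hn : 1 ≤ n)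
    {W : Set (ℝ × ℝ)} (hW : ∀ j < n, ∃ A ∈ markovAtoms, skewProd^[j] '' W ⊆ A)
    (hbij : Set.BijOn skewProd^[n] W S) :
    ∃ (φ : ℝ × ℝ → ℝ × ℝ) (M : ℝ), 0 < M ∧
      ∀ z ∈ S, φ z ∈ W ∧ skewProd^[n] (φ z) = z ∧
        ∃ J, HasAbsJacobianAt φ J z ∧ M * ω z / 8 ≤ J ∧ J ≤ M * ω z := by
  obtain ⟨φ, p, p', q, q', hp, -, hq, hqq, hq', -, hpp, hφ, hJ⟩ :=
    exists_tile_inverse hS n W hW hbij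
  obtain ⟨hpp, hp'⟩ := hpp hn
  have hx : ∀ z ∈ S, 0 < z.1 ∧ z.1 < 1 ∧ 0 ≤ ω z := by
    rintro z hz
    rcases hS with ⟨rfl, rfl⟩ | ⟨rfl, rfl⟩
    · exact ⟨hz.1.1, hz.1.2, zero_le_one⟩
    · exact ⟨hz.1.1, hz.1.2, hz.1.1.le⟩
  have hlin : ∀ {a b : ℝ}, 0 ≤ a → a ≤ b → ∀ z ∈ S, b ≤ a * z.1 + b ∧ a * z.1 + b ≤ 2 * b := by
    intro a b ha hab z hz
    obtain ⟨h0, h1, -⟩ := hx z hz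
    constructor <;> nlinarith
  have hdiv : ∀ {w m L : ℝ}, 0 ≤ w → 0 < m → m ≤ L → L ≤ 8 * m →
      1 / m * w / 8 ≤ w / L ∧ w / L ≤ 1 / m * w := by
    intro w m L hw hm h1 h2
    have e1 : 1 / m * w / 8 = w / (8 * m) := by field_simp
    have e2 : 1 / m * w = w / m := by field_simp
    rw [e1, e2]
    exact ⟨div_le_div_of_nonneg_left hw (hm.trans_le h1) h2, div_le_div_of_nonneg_left hw hm h1⟩
  rcases hJ with hJ | hJ
  · refine ⟨φ, 1 / q' ^ 3, by positivity,
      fun z hz => ⟨(hφ z hz).1, (hφ z hz).2.1, _, (hJ z hz).2, ?_⟩⟩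
    obtain ⟨h1, h2⟩ := hlin hq hqq z hz
    refine hdiv (hx z hz).2.2 (by positivity) (by gcongr) ?_
    calc (q * z.1 + q') ^ 3 ≤ (2 * q') ^ 3 := by gcongr; linarith
      _ = 8 * q' ^ 3 := by ring
  · refine ⟨φ, 1 / (q' ^ 2 * p'), by positivity,
      fun z hz => ⟨(hφ z hz).1, (hφ z hz).2.1, _, (hJ z hz).2, ?_⟩⟩
    obtain ⟨h1, h2⟩ := hlin hq hqq z hz
    obtain ⟨h3, h4⟩ := hlin hp hpp z hz
    refine hdiv (hx z hz).2.2 (by positivity) (by gcongr) ?_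
    calc (q * z.1 + q') ^ 2 * (p * z.1 + p') ≤ (2 * q') ^ 2 * (2 * p') := by
          gcongr <;> linarith
      _ = 8 * (q' ^ 2 * p') := by ring

/-- **Lemma A.8.** If `A ⊆ R⁺` (resp. `A ⊆ R⁻`) is a Borel set of positive Lebesgue measure,
then there is `0 < c_A < 1` such that for every `n ≥ 1` and every Markov `n`-tile `W` with
`Tⁿ(W) = R⁺` (resp. `R⁻`), one has `Leb(W ∩ T⁻ⁿ(A)) ≥ c_A · Leb(W)`. -/
theorem markovTilesMass (S : Set (ℝ × ℝ)) (hS : S = Rplus ∨ S = Rminus)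
    (A : Set (ℝ × ℝ)) (hAS : A ⊆ S) (hAm : MeasurableSet A) (hApos : 0 < volume A) :
    ∃ c : ℝ, 0 < c ∧ c < 1 ∧
      ∀ (n : ℕ), 1 ≤ n → ∀ W : Set (ℝ × ℝ), IsMarkovTile n W →
        Set.BijOn skewProd^[n] W S →
        ENNReal.ofReal c * volume W ≤ volume (W ∩ skewProd^[n] ⁻¹' A) := by
  obtain ⟨ω, hω⟩ : ∃ ω : ℝ × ℝ → ℝ,
      (S = Rplus ∧ ω = fun _ => 1) ∨ (S = Rminus ∧ ω = Prod.fst) := by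
    rcases hS with h | h
    · exact ⟨_, Or.inl ⟨h, rfl⟩⟩
    · exact ⟨_, Or.inr ⟨h, rfl⟩⟩
  have hSm : MeasurableSet S := by
    rcases hS with rfl | rfl <;> exact measurableSet_Ioo.prod measurableSet_Ioo
  have hSvol : volume S = 1 := by
    rcases hS with rfl | rfl <;>
      simp [Rplus, Rminus, Measure.volume_eq_prod, Measure.prod_prod]
  have hbd : ∀ z ∈ S, 0 < z.1 ∧ z.1 ≤ 1 ∧ z.1 ≤ ω z ∧ ω z ≤ 1 := by
    intro z hz
    rcases hω with ⟨rfl, rfl⟩ | ⟨rfl, rfl⟩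
    · exact ⟨hz.1.1, hz.1.2.le, hz.1.2.le, le_rfl⟩
    · exact ⟨hz.1.1, hz.1.2.le, le_rfl, hz.1.2.le⟩
  set I : ENNReal := ∫⁻ z in A, ENNReal.ofReal z.1 with hI
  have hI0 : I ≠ 0 := by
    rw [hI, ← pos_iff_ne_zero, setLIntegral_pos_iff (by fun_prop)]
    refine hApos.trans_le (measure_mono fun z hz => ⟨?_, hz⟩)
    simpa using (hbd z (hAS hz)).1
  have hI1 : I ≤ 1 := by
    calc I ≤ ∫⁻ _ in A, 1 := setLIntegral_mono measurable_const fun z hz => by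
          simpa using (hbd z (hAS hz)).2.1
      _ = volume A := by simp
      _ ≤ 1 := hSvol ▸ measure_mono hAS
  have hItop : I ≠ ⊤ := (hI1.trans_lt ENNReal.one_lt_top).ne
  have hIr : I.toReal ≤ 1 := ENNReal.toReal_le_of_le_ofReal zero_le_one (by simpa using hI1)
  refine ⟨I.toReal / 8, div_pos (ENNReal.toReal_pos hI0 hItop) (by norm_num), by linarith, ?_⟩
  intro n hn W hW hbij
  obtain ⟨φ, M, hM, hφ⟩ := exists_tile_inverse_bounded hω hn hW.2.2.1 hbij
  have hvol : ∀ B ⊆ S, MeasurableSet B →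
      volume (W ∩ skewProd^[n] ⁻¹' B) = ∫⁻ z in B, ENNReal.ofReal |(fderiv ℝ φ z).det| := by
    intro B hBS hBm
    have hderiv : ∀ z ∈ B, HasFDerivWithinAt φ (fderiv ℝ φ z) B z := fun z hz => by
      obtain ⟨-, -, J, ⟨D, hD, -⟩, -⟩ := hφ z (hBS hz)
      exact hD.differentiableAt.hasFDerivAt.hasFDerivWithinAt
    have hinj : InjOn φ B := fun z hz z' hz' h => by
      rw [← (hφ z (hBS hz)).2.1, h, (hφ z' (hBS hz')).2.1]
    rw [lintegral_abs_det_fderiv_eq_addHaar_image volume hBm hderiv hinj]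
    congr 1
    ext w
    constructor
    · rintro ⟨hw, hwB⟩
      refine ⟨_, hwB, hbij.injOn (hφ _ (hBS hwB)).1 hw (hφ _ (hBS hwB)).2.1⟩
    · rintro ⟨z, hz, rfl⟩
      exact ⟨(hφ z (hBS hz)).1, by rwa [mem_preimage, (hφ z (hBS hz)).2.1]⟩
  have hdet : ∀ z ∈ S, M * z.1 / 8 ≤ |(fderiv ℝ φ z).det| ∧ |(fderiv ℝ φ z).det| ≤ M := by
    intro z hz
    obtain ⟨-, -, J, ⟨D, hD, rfl⟩, h1, h2⟩ := hφ z hz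
    obtain ⟨-, -, h3, h4⟩ := hbd z hz
    rw [hD.fderiv]
    constructor <;> nlinarith
  have hWvol : volume W ≤ ENNReal.ofReal M := by
    have h := hvol S subset_rfl hSm
    rw [inter_eq_left.2 (mapsTo_iff_subset_preimage.1 hbij.mapsTo)] at h
    rw [h]
    calc _ ≤ ∫⁻ _ in S, ENNReal.ofReal M := setLIntegral_mono measurable_const fun z hz =>
          ENNReal.ofReal_le_ofReal (hdet z hz).2
      _ = ENNReal.ofReal M := by simp [hSvol]
  rw [hvol A hAS hAm]
  calc ENNReal.ofReal (I.toReal / 8) * volume W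
      ≤ ENNReal.ofReal (I.toReal / 8) * ENNReal.ofReal M := by gcongr
    _ = ENNReal.ofReal (M / 8) * I := by
        rw [← ENNReal.ofReal_mul (by positivity), ← ENNReal.ofReal_toReal hItop,
          ← ENNReal.ofReal_mul (by positivity), ENNReal.toReal_ofReal ENNReal.toReal_nonneg]
        congr 1
        ring
    _ = ∫⁻ z in A, ENNReal.ofReal (M / 8) * ENNReal.ofReal z.1 :=
        (lintegral_const_mul _ (by fun_prop)).symm
    _ ≤ _ := setLIntegral_mono' hAm fun z hz => by
        rw [← ENNReal.ofReal_mul (by positivity)]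
        exact ENNReal.ofReal_le_ofReal (by linarith [(hdet z (hAS hz)).1])
end
end

section
/- If B⊆R is a Borel set of positive Lebesgue measure, then the set R ∖ ⋃_{n≥0} T^{−n}(B) has Lebesgue measure zero. -/
noncomputable section

open Set Filter MeasureTheory Topology

namespace SkewProduct

/-- A plane projective map `(x, y) ↦ ((p₀ + p₁ x) / (q₀ + q₁ x), (a₀ + a₁ x + c y) / (q₀ + q₁ x))`,
given by its coefficients. -/
structure ProjMap where
  /-- Constant term of the first numerator. -/
  p₀ : ℝ
  /-- Linear term of the first numerator. -/
  p₁ : ℝ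
  /-- Constant term of the denominator. -/
  q₀ : ℝ
  /-- Linear term of the denominator. -/
  q₁ : ℝ
  /-- Constant term of the second numerator. -/
  a₀ : ℝ
  /-- Coefficient of `x` in the second numerator. -/
  a₁ : ℝ
  /-- Coefficient of `y` in the second numerator. -/
  c : ℝ

namespace ProjMap

/-- The map of the plane described by the coefficients. -/
def toFun (M : ProjMap) (u : ℝ × ℝ) : ℝ × ℝ :=
  ((M.p₀ + M.p₁ * u.1) / (M.q₀ + M.q₁ * u.1),
    (M.a₀ + M.a₁ * u.1 + M.c * u.2) / (M.q₀ + M.q₁ * u.1))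

/-- The coefficients of the identity. -/
def ident : ProjMap := ⟨0, 1, 1, 0, 0, 0, 1⟩

theorem ident_toFun (u : ℝ × ℝ) : ident.toFun u = u := by
  simp [toFun, ident]

/-- The coefficients of the composition of `M` with the inverse branch `branch n m`. -/
def next (M : ProjMap) (n m : ℕ) : ProjMap where
  p₀ := M.p₀ * n + M.p₁
  p₁ := M.p₀
  q₀ := M.q₀ * n + M.q₁
  q₁ := M.q₀
  a₀ := M.a₀ * n + M.a₁ + M.c * m
  a₁ := M.a₀ + M.c * (if m = 0 then 0 else 1)
  c := -M.c

/-- The bounds on the coefficients of the inverse branches of rank `k` of the skew product. -/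
structure Admissible (M : ProjMap) (k : ℕ) : Prop where
  det_sq : (M.p₁ * M.q₀ - M.p₀ * M.q₁) ^ 2 = 1
  c_sq : M.c ^ 2 = 1
  one_le : 1 ≤ M.q₀
  nonneg : 0 ≤ M.q₁
  le : M.q₁ ≤ M.q₀
  rank_le : (k : ℝ) + 1 ≤ M.q₀ + M.q₁
  slope_le : |M.a₁ * M.q₀ - M.a₀ * M.q₁| ≤ 2 * M.q₀ + M.q₁

theorem admissible_ident : ident.Admissible 0 := by
  constructor <;> norm_num [ident]

theorem Admissible.next {M : ProjMap} {k n m : ℕ} (h : M.Admissible k) (hn : 1 ≤ n) (hm : m ≤ n) :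
    (M.next n m).Admissible (k + 1) := by
  have hn' : (1 : ℝ) ≤ n := by exact_mod_cast hn
  have hm' : (m : ℝ) ≤ n := by exact_mod_cast hm
  have hq : M.q₀ ≤ M.q₀ * n := le_mul_of_one_le_right (by linarith [h.one_le]) hn'
  have h1 := h.one_le
  have h2 := h.nonneg
  have h3 := h.le
  have h4 := h.rank_le
  constructor
  · simp only [ProjMap.next]
    rw [← h.det_sq]; ring
  · simp only [ProjMap.next]
    rw [← h.c_sq]; ring
  · simp only [ProjMap.next]; linarith
  · simp only [ProjMap.next]; linarith
  · simp only [ProjMap.next]; linarith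
  · simp only [ProjMap.next]; push_cast; linarith
  · have hc : |M.c| = 1 := by
      rw [← sq_eq_sq₀ (abs_nonneg _) zero_le_one, sq_abs, h.c_sq, one_pow]
    set f : ℝ := if m = 0 then 0 else 1 with hf
    have key : |f * (M.q₀ * n + M.q₁) - m * M.q₀| ≤ M.q₀ * n + M.q₁ := by
      rw [abs_le]
      by_cases h0 : m = 0
      · simp only [hf, h0, if_true, Nat.cast_zero]
        constructor <;> nlinarith
      · simp only [hf, h0, if_false]
        have : (0 : ℝ) ≤ m := m.cast_nonneg
        constructor <;> nlinarith
    have hexp : (M.next n m).a₁ * (M.next n m).q₀ - (M.next n m).a₀ * (M.next n m).q₁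
        = -(M.a₁ * M.q₀ - M.a₀ * M.q₁) + M.c * (f * (M.q₀ * n + M.q₁) - m * M.q₀) := by
      simp only [ProjMap.next]; ring
    rw [hexp]
    refine (abs_add_le _ _).trans ?_
    rw [abs_neg, abs_mul, hc, one_mul]
    simp only [ProjMap.next]
    linarith [h.slope_le]

section Admissible

variable {M : ProjMap} {k : ℕ} {u v : ℝ × ℝ}

theorem Admissible.le_denom (h : M.Admissible k) (hu : 0 ≤ u.1) :
    M.q₀ ≤ M.q₀ + M.q₁ * u.1 := by
  nlinarith [mul_nonneg h.nonneg hu]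

theorem Admissible.denom_le (h : M.Admissible k) (hu : u.1 ≤ 1) :
    M.q₀ + M.q₁ * u.1 ≤ 2 * M.q₀ := by
  nlinarith [mul_le_mul_of_nonneg_left hu h.nonneg, h.le]

theorem Admissible.denom_pos (h : M.Admissible k) (hu : 0 ≤ u.1) :
    0 < M.q₀ + M.q₁ * u.1 :=
  lt_of_lt_of_le (by linarith [h.one_le]) (h.le_denom hu)

theorem Admissible.injOn (h : M.Admissible k) : InjOn M.toFun {u | 0 ≤ u.1} := by
  rintro u hu v hv huv
  have hQu := h.denom_pos hu
  have hQv := h.denom_pos hv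
  simp only [toFun, Prod.mk.injEq] at huv
  obtain ⟨h1, h2⟩ := huv
  rw [div_eq_div_iff hQu.ne' hQv.ne'] at h1
  have hd : M.p₁ * M.q₀ - M.p₀ * M.q₁ ≠ 0 := by
    intro h0; have := h.det_sq; rw [h0] at this; norm_num at this
  have hx : u.1 = v.1 := by
    have : (M.p₁ * M.q₀ - M.p₀ * M.q₁) * (u.1 - v.1) = 0 := by linear_combination h1
    linarith [(mul_eq_zero.1 this).resolve_left hd]
  rw [hx, div_left_inj' hQv.ne'] at h2
  have hc : M.c ≠ 0 := by
    intro h0; have := h.c_sq; rw [h0] at this; norm_num at this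
  refine Prod.ext hx (mul_left_cancel₀ hc ?_)
  linarith

theorem Admissible.dist_le (h : M.Admissible k) (hu : u ∈ Icc (0 : ℝ) 1 ×ˢ Icc (-1 : ℝ) 1)
    (hv : v ∈ Icc (0 : ℝ) 1 ×ˢ Icc (-1 : ℝ) 1) :
    dist (M.toFun u) (M.toFun v) ≤ 14 / (k + 1) := by
  obtain ⟨⟨hu0, hu1⟩, hu2, hu3⟩ := hu
  obtain ⟨⟨hv0, hv1⟩, hv2, hv3⟩ := hv
  have hQu := h.denom_pos hu0
  have hQv := h.denom_pos hv0
  have hq := h.one_le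
  have hk : (0 : ℝ) < k + 1 := by positivity
  have hkq : 7 / M.q₀ ≤ 14 / ((k : ℝ) + 1) := by
    rw [div_le_div_iff₀ (by linarith) hk]
    linarith [h.rank_le, h.le]
  have hprod : M.q₀ * M.q₀ ≤ (M.q₀ + M.q₁ * u.1) * (M.q₀ + M.q₁ * v.1) :=
    mul_le_mul (h.le_denom hu0) (h.le_denom hv0) (by linarith) hQu.le
  have hd : |M.p₁ * M.q₀ - M.p₀ * M.q₁| = 1 := by
    rw [← sq_eq_sq₀ (abs_nonneg _) zero_le_one, sq_abs, h.det_sq, one_pow]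
  have hc : |M.c| = 1 := by
    rw [← sq_eq_sq₀ (abs_nonneg _) zero_le_one, sq_abs, h.c_sq, one_pow]
  have hxy : |u.1 - v.1| ≤ 1 := abs_le.2 ⟨by linarith, by linarith⟩
  have bound : ∀ a : ℝ, |a| ≤ 7 * M.q₀ →
      |a / ((M.q₀ + M.q₁ * u.1) * (M.q₀ + M.q₁ * v.1))| ≤ 14 / ((k : ℝ) + 1) := by
    intro a ha
    refine le_trans ?_ hkq
    rw [abs_div, abs_of_pos (mul_pos hQu hQv), div_le_div_iff₀ (mul_pos hQu hQv) (by linarith)]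
    nlinarith [abs_nonneg a]
  rw [Prod.dist_eq, max_le_iff, Real.dist_eq, Real.dist_eq]
  simp only [toFun]
  rw [div_sub_div _ _ hQu.ne' hQv.ne', div_sub_div _ _ hQu.ne' hQv.ne']
  constructor
  · apply bound
    have : (M.p₀ + M.p₁ * u.1) * (M.q₀ + M.q₁ * v.1) - (M.q₀ + M.q₁ * u.1) * (M.p₀ + M.p₁ * v.1)
        = (M.p₁ * M.q₀ - M.p₀ * M.q₁) * (u.1 - v.1) := by ring
    rw [this, abs_mul, hd]
    linarith
  · apply bound
    have : (M.a₀ + M.a₁ * u.1 + M.c * u.2) * (M.q₀ + M.q₁ * v.1)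
          - (M.q₀ + M.q₁ * u.1) * (M.a₀ + M.a₁ * v.1 + M.c * v.2)
        = (M.a₁ * M.q₀ - M.a₀ * M.q₁) * (u.1 - v.1)
          + M.c * (u.2 * (M.q₀ + M.q₁ * v.1) - v.2 * (M.q₀ + M.q₁ * u.1)) := by ring
    rw [this]
    have hu' : |u.2| ≤ 1 := abs_le.2 ⟨hu2, hu3⟩
    have hv' : |v.2| ≤ 1 := abs_le.2 ⟨hv2, hv3⟩
    have e1 : |(M.a₁ * M.q₀ - M.a₀ * M.q₁) * (u.1 - v.1)| ≤ 3 * M.q₀ := by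
      rw [abs_mul]
      nlinarith [abs_nonneg (M.a₁ * M.q₀ - M.a₀ * M.q₁), h.slope_le, h.le]
    have e2 : |u.2 * (M.q₀ + M.q₁ * v.1)| ≤ 2 * M.q₀ := by
      rw [abs_mul, abs_of_pos hQv]
      nlinarith [h.denom_le hv1]
    have e3 : |v.2 * (M.q₀ + M.q₁ * u.1)| ≤ 2 * M.q₀ := by
      rw [abs_mul, abs_of_pos hQu]
      nlinarith [h.denom_le hu1]
    refine (abs_add_le _ _).trans ?_
    rw [abs_mul M.c, hc, one_mul]
    linarith [abs_sub (u.2 * (M.q₀ + M.q₁ * v.1)) (v.2 * (M.q₀ + M.q₁ * u.1))]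

/-- The derivative of a projective map. -/
def fderivMap (M : ProjMap) (u : ℝ × ℝ) : ℝ × ℝ →L[ℝ] ℝ × ℝ :=
  (Matrix.toLin (.finTwoProd ℝ) (.finTwoProd ℝ)
    !![(M.p₁ * M.q₀ - M.p₀ * M.q₁) / (M.q₀ + M.q₁ * u.1) ^ 2, 0;
      (M.a₁ * M.q₀ - M.q₁ * (M.a₀ + M.c * u.2)) / (M.q₀ + M.q₁ * u.1) ^ 2,
      M.c / (M.q₀ + M.q₁ * u.1)]).toContinuousLinearMap

theorem hasFDerivAt_toFun (hQ : M.q₀ + M.q₁ * u.1 ≠ 0) :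
    HasFDerivAt M.toFun (M.fderivMap u) u := by
  unfold fderivMap
  rw [Matrix.toLin_finTwoProd_toContinuousLinearMap]
  have hx : HasFDerivAt (fun w : ℝ × ℝ => w.1) (ContinuousLinearMap.fst ℝ ℝ ℝ) u := hasFDerivAt_fst
  have hy : HasFDerivAt (fun w : ℝ × ℝ => w.2) (ContinuousLinearMap.snd ℝ ℝ ℝ) u := hasFDerivAt_snd
  have hden := (hx.const_mul M.q₁).const_add M.q₀
  have hinv := (hasDerivAt_inv hQ).comp_hasFDerivAt u hden
  have h1 := ((hx.const_mul M.p₁).const_add M.p₀).mul hinv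
  have h2 := (((hx.const_mul M.a₁).const_add M.a₀).add (hy.const_mul M.c)).mul hinv
  refine (h1.prodMk h2).congr_fderiv ?_
  ext <;> simp <;> field_simp <;> ring

theorem det_fderivMap (M : ProjMap) (u : ℝ × ℝ) :
    (M.fderivMap u).det
      = (M.p₁ * M.q₀ - M.p₀ * M.q₁) * M.c / (M.q₀ + M.q₁ * u.1) ^ 3 := by
  unfold fderivMap
  simp only [LinearMap.det_toContinuousLinearMap, LinearMap.det_toLin, Matrix.det_fin_two_of]
  rw [div_mul_div_comm]
  ring

theorem Admissible.abs_det_fderivMap (h : M.Admissible k) (hu : 0 ≤ u.1) :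
    |(M.fderivMap u).det| = 1 / (M.q₀ + M.q₁ * u.1) ^ 3 := by
  have hd : |M.p₁ * M.q₀ - M.p₀ * M.q₁| = 1 := by
    rw [← sq_eq_sq₀ (abs_nonneg _) zero_le_one, sq_abs, h.det_sq, one_pow]
  have hc : |M.c| = 1 := by
    rw [← sq_eq_sq₀ (abs_nonneg _) zero_le_one, sq_abs, h.c_sq, one_pow]
  rw [det_fderivMap, abs_div, abs_mul, hd, hc, abs_of_pos (pow_pos (h.denom_pos hu) 3), one_mul]

variable {A : Set (ℝ × ℝ)}

theorem Admissible.measurableSet_image (h : M.Admissible k) (hA : MeasurableSet A)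
    (hA0 : ∀ u ∈ A, 0 ≤ u.1) : MeasurableSet (M.toFun '' A) :=
  measurable_image_of_fderivWithin hA
    (fun u hu => (hasFDerivAt_toFun (h.denom_pos (hA0 u hu)).ne').hasFDerivWithinAt)
    (h.injOn.mono hA0)

theorem Admissible.volume_image (h : M.Admissible k) (hA : MeasurableSet A)
    (hA0 : ∀ u ∈ A, 0 ≤ u.1) :
    volume (M.toFun '' A) = ∫⁻ u in A, ENNReal.ofReal (1 / (M.q₀ + M.q₁ * u.1) ^ 3) := by
  rw [← lintegral_abs_det_fderiv_eq_addHaar_image volume hA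
    (fun u hu => (hasFDerivAt_toFun (h.denom_pos (hA0 u hu)).ne').hasFDerivWithinAt)
    (h.injOn.mono hA0)]
  exact setLIntegral_congr_fun hA fun u hu => by
    simp only [h.abs_det_fderivMap (hA0 u hu)]

theorem Admissible.volume_image_le (h : M.Admissible k) (hA : MeasurableSet A)
    (hA0 : ∀ u ∈ A, 0 ≤ u.1) :
    volume (M.toFun '' A) ≤ ENNReal.ofReal (1 / M.q₀ ^ 3) * volume A := by
  rw [h.volume_image hA hA0, ← setLIntegral_const]
  refine setLIntegral_mono measurable_const fun u hu => ENNReal.ofReal_le_ofReal ?_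
  have := h.one_le
  have := h.le_denom (hA0 u hu)
  gcongr

theorem Admissible.le_volume_image (h : M.Admissible k) (hA : MeasurableSet A)
    (hA0 : ∀ u ∈ A, 0 ≤ u.1) (hA1 : ∀ u ∈ A, u.1 ≤ 1) :
    ENNReal.ofReal (1 / 8) * ENNReal.ofReal (1 / M.q₀ ^ 3) * volume A ≤ volume (M.toFun '' A) := by
  rw [h.volume_image hA hA0, ← setLIntegral_const, ← ENNReal.ofReal_mul (by norm_num)]
  refine setLIntegral_mono' hA fun u hu => ENNReal.ofReal_le_ofReal ?_
  have h1 := h.denom_pos (hA0 u hu)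
  have h2 := h.denom_le (hA1 u hu)
  calc 1 / 8 * (1 / M.q₀ ^ 3) = 1 / (2 * M.q₀) ^ 3 := by rw [mul_pow]; field_simp; norm_num
    _ ≤ _ := by gcongr

end Admissible

end ProjMap

/-- If arbitrarily fine countable partitions consist of cells in which the complement of `F` has
relative measure bounded below, then `F` is a null set. -/
theorem measure_eq_zero_of_fine_partitions {X : Type*} [MetricSpace X] [ProperSpace X]
    [MeasurableSpace X] [BorelSpace X] (μ : Measure X) [IsFiniteMeasureOnCompacts μ]
    [μ.InnerRegular] {𝒞 : ℕ → Set (Set X)} {δ : ℕ → ℝ} {F : Set X} {c : ENNReal}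
    (hδ : Tendsto δ atTop (𝓝 0)) (hcount : ∀ k, (𝒞 k).Countable)
    (hdisj : ∀ k, (𝒞 k).PairwiseDisjoint id) (hmeas : ∀ k, ∀ C ∈ 𝒞 k, MeasurableSet C)
    (hdist : ∀ k, ∀ C ∈ 𝒞 k, ∀ x ∈ C, ∀ y ∈ C, dist x y ≤ δ k)
    (hF : MeasurableSet F) (hcover : ∀ k, μ (F \ ⋃₀ 𝒞 k) = 0) (hc : c ≠ 0)
    (hdens : ∀ k, ∀ C ∈ 𝒞 k, c * μ C ≤ μ (C \ F)) : μ F = 0 := by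
  by_contra hne
  obtain ⟨K, hKF, hK, hKpos⟩ := hF.exists_lt_isCompact (pos_iff_ne_zero.2 hne)
  have key : ∀ k, μ K + c * μ K ≤ μ (Metric.cthickening (δ k) K) := by
    intro k
    set S : Set (Set X) := {C ∈ 𝒞 k | (C ∩ K).Nonempty}
    have hSsub : S ⊆ 𝒞 k := sep_subset _ _
    have hSc : S.Countable := (hcount k).mono hSsub
    have hSd : S.PairwiseDisjoint id := (hdisj k).subset hSsub
    have hV : ⋃₀ S ⊆ Metric.cthickening (δ k) K := by
      rintro x ⟨C, ⟨hC, y, hyC, hyK⟩, hxC⟩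
      exact Metric.mem_cthickening_of_dist_le x y _ _ hyK (hdist k C hC x hxC y hyC)
    have hKV : μ K ≤ μ (⋃₀ S ∩ F) := by
      have hsub : K ⊆ (⋃₀ S ∩ F) ∪ (F \ ⋃₀ 𝒞 k) := by
        intro x hx
        by_cases hx' : x ∈ ⋃₀ 𝒞 k
        · obtain ⟨C, hC, hxC⟩ := hx'
          exact Or.inl ⟨⟨C, ⟨hC, x, hxC, hx⟩, hxC⟩, hKF hx⟩
        · exact Or.inr ⟨hKF hx, hx'⟩
      refine (measure_mono hsub).trans ((measure_union_le _ _).trans ?_)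
      rw [hcover k, add_zero]
    have hVF : c * μ (⋃₀ S) ≤ μ (⋃₀ S \ F) := by
      have hdiff : ⋃₀ S \ F = ⋃ C ∈ S, C \ F := by
        ext x
        simp only [Set.mem_sdiff, mem_sUnion, mem_iUnion, exists_prop]
        grind
      rw [hdiff, measure_sUnion hSc hSd fun C hC => hmeas k C (hSsub hC),
        measure_biUnion (f := fun C => C \ F) hSc (hSd.mono fun C => sdiff_subset)
          fun C hC => (hmeas k C (hSsub hC)).diff hF, ← ENNReal.tsum_mul_left]
      exact ENNReal.tsum_le_tsum fun C => hdens k C (hSsub C.2)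
    calc μ K + c * μ K ≤ μ (⋃₀ S ∩ F) + μ (⋃₀ S \ F) :=
          add_le_add hKV
            ((mul_le_mul_right (hKV.trans (measure_mono inter_subset_left)) c).trans hVF)
      _ = μ (⋃₀ S) := measure_inter_add_sdiff _ hF
      _ ≤ _ := measure_mono hV
  have hlim : μ K + c * μ K ≤ μ K :=
    ge_of_tendsto' ((tendsto_measure_cthickening_of_isCompact hK).comp hδ) key
  have hzero : c * μ K = 0 := by
    have : μ K + c * μ K ≤ μ K + 0 := by simpa using hlim
    exact le_zero_iff.1 ((ENNReal.add_le_add_iff_left hK.measure_lt_top.ne).1 this)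
  rcases mul_eq_zero.1 hzero with h | h
  · exact hc h
  · exact hKpos.ne' h

theorem volume_line {a b : ℝ} (h : a ≠ 0 ∨ b ≠ 0) (c : ℝ) :
    volume {u : ℝ × ℝ | a * u.1 + b * u.2 = c} = 0 := by
  have hm : MeasurableSet {u : ℝ × ℝ | a * u.1 + b * u.2 = c} :=
    measurableSet_eq_fun (by fun_prop) measurable_const
  rw [Measure.volume_eq_prod, Measure.measure_prod_null hm]
  by_cases hb : b = 0
  · have ha := h.resolve_right (not_not.2 hb)
    have hae : ∀ᵐ x : ℝ, x ≠ c / a := Measure.ae_ne volume (c / a)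
    filter_upwards [hae] with x hx
    have : Prod.mk x ⁻¹' {u : ℝ × ℝ | a * u.1 + b * u.2 = c} = ∅ := by
      ext y
      simp only [hb, mem_preimage, mem_ofPred_eq, zero_mul, add_zero, mem_empty_iff_false, iff_false]
      exact fun h' => hx (by rw [← h']; field_simp)
    simp [this]
  · refine Eventually.of_forall fun x => Set.Subsingleton.measure_zero ?_ _
    intro y hy z hz
    simp only [mem_preimage, mem_ofPred_eq] at hy hz
    exact mul_left_cancel₀ hb (by linarith)

/-- The upper unit square (`true`), and the triangle `-x < y < 0` (`false`) which is the lower unit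
square with its fibers rescaled. -/
def cell : Bool → Set (ℝ × ℝ)
  | true => {u | 0 < u.1 ∧ u.1 < 1 ∧ 0 < u.2 ∧ u.2 < 1}
  | false => {u | 0 < u.1 ∧ u.1 < 1 ∧ -u.1 < u.2 ∧ u.2 < 0}

theorem fst_pos {s : Bool} {u : ℝ × ℝ} (hu : u ∈ cell s) : 0 < u.1 := by
  cases s <;> exact hu.1

theorem fst_lt_one {s : Bool} {u : ℝ × ℝ} (hu : u ∈ cell s) : u.1 < 1 := by
  cases s <;> exact hu.2.1

theorem cell_subset_rect (s : Bool) : cell s ⊆ Icc (0 : ℝ) 1 ×ˢ Icc (-1 : ℝ) 1 := by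
  intro u hu
  cases s <;> obtain ⟨h1, h2, h3, h4⟩ := hu <;>
    exact ⟨⟨by linarith, by linarith⟩, by linarith, by linarith⟩

theorem measurableSet_cell (s : Bool) : MeasurableSet (cell s) := by
  cases s <;> simp only [cell] <;> measurability

theorem volume_cell_le (s : Bool) : volume (cell s) ≤ 1 := by
  have h : ∃ a : ℝ, cell s ⊆ Ioo (0 : ℝ) 1 ×ˢ Ioo a (a + 1) := by
    cases s
    · refine ⟨-1, fun u hu => ?_⟩
      obtain ⟨h1, h2, h3, h4⟩ := hu
      exact ⟨⟨h1, h2⟩, by linarith, by linarith⟩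
    · refine ⟨0, fun u hu => ?_⟩
      obtain ⟨h1, h2, h3, h4⟩ := hu
      exact ⟨⟨h1, h2⟩, by linarith, by linarith⟩
  obtain ⟨a, ha⟩ := h
  refine (measure_mono ha).trans ?_
  rw [Measure.volume_eq_prod, Measure.prod_prod]
  simp

/-- The map undoing the rescaling of the fibers below the horizontal axis. -/
def toRect (u : ℝ × ℝ) : ℝ × ℝ := (u.1, if 0 < u.2 then u.2 else u.2 / u.1)

theorem measurable_toRect : Measurable toRect := by
  unfold toRect
  refine measurable_fst.prodMk (Measurable.ite ?_ measurable_snd (by fun_prop))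
  exact measurableSet_lt measurable_const measurable_snd

theorem toRect_of_mem_true {u : ℝ × ℝ} (hu : u ∈ cell true) : toRect u = u := by
  simp [toRect, hu.2.2.1]

theorem toRect_of_mem_false {u : ℝ × ℝ} (hu : u ∈ cell false) :
    toRect u = (u.1, u.2 / u.1) := by
  simp [toRect, not_lt.2 hu.2.2.2.le]

theorem toRect_injOn : InjOn toRect {u | 0 < u.1} := by
  rintro ⟨x, y⟩ hu ⟨x', y'⟩ hv h
  simp only [toRect, Prod.mk.injEq] at h
  simp only [mem_ofPred_eq] at hu hv
  obtain ⟨rfl, h⟩ := h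
  have hneg : ∀ z : ℝ, ¬ 0 < z → z / x ≤ 0 :=
    fun z hz => div_nonpos_of_nonpos_of_nonneg (not_lt.1 hz) hu.le
  split_ifs at h with h1 h2 h2
  · rw [h]
  · exact absurd (hneg _ h2) (by linarith)
  · exact absurd (hneg _ h1) (by linarith)
  · rw [(div_left_inj' hu.ne').1 h]

/-- The labels of the inverse branches of the rescaled skew product that land in `cell s`. -/
def IsDigit (s : Bool) (n m : ℕ) : Prop := 1 ≤ n ∧ m ≤ n ∧ (s = false → m = 0)

/-- The cell on which the inverse branch with second label `m` landing in `cell s` is defined. -/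
def nextState (s : Bool) (m : ℕ) : Bool := if m = 0 then !s else true

/-- The inverse branches of the rescaled skew product. -/
def branch (n m : ℕ) (u : ℝ × ℝ) : ℝ × ℝ :=
  (1 / (n + u.1), (m + (if m = 0 then 0 else 1) * u.1 - u.2) / (n + u.1))

theorem branch_mem {s : Bool} {n m : ℕ} {u : ℝ × ℝ} (hd : IsDigit s n m)
    (hu : u ∈ cell (nextState s m)) : branch n m u ∈ cell s := by
  obtain ⟨hn, hm, hs⟩ := hd
  have hn' : (1 : ℝ) ≤ n := by exact_mod_cast hn
  have hx0 := fst_pos hu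
  have hpos : (0 : ℝ) < n + u.1 := by linarith
  have h1 : 1 / ((n : ℝ) + u.1) < 1 := by rw [div_lt_one hpos]; linarith
  have h0 : 0 < 1 / ((n : ℝ) + u.1) := by positivity
  rcases Nat.eq_zero_or_pos m with rfl | hmpos
  · cases s
    · obtain ⟨h2, h3, h4, h5⟩ := hu
      refine ⟨h0, h1, ?_, ?_⟩
      · simp only [branch, ← neg_div]
        rw [div_lt_div_iff_of_pos_right hpos]
        simp; linarith
      · simp only [branch]
        exact div_neg_of_neg_of_pos (by simp; linarith) hpos
    · obtain ⟨h2, h3, h4, h5⟩ := hu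
      refine ⟨h0, h1, ?_, ?_⟩
      · exact div_pos (by simp; linarith) hpos
      · simp only [branch]
        rw [div_lt_one hpos]
        simp; linarith
  · have hst : s = true := by
      cases s
      · exact absurd (hs rfl) hmpos.ne'
      · rfl
    subst hst
    rw [nextState, if_neg hmpos.ne'] at hu
    obtain ⟨h2, h3, h4, h5⟩ := hu
    have hm1 : (1 : ℝ) ≤ m := by exact_mod_cast hmpos
    have hm2 : (m : ℝ) ≤ n := by exact_mod_cast hm
    refine ⟨h0, h1, ?_, ?_⟩
    · simp only [branch, if_neg hmpos.ne']
      exact div_pos (by linarith) hpos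
    · simp only [branch, if_neg hmpos.ne']
      rw [div_lt_one hpos]; linarith

theorem gaussMap_one_div {n : ℕ} {x : ℝ} (hn : 1 ≤ n) (h0 : 0 < x) (h1 : x < 1) :
    gaussMap (1 / (n + x)) = x := by
  have : (0 : ℝ) < n + x := by positivity
  rw [gaussMap, if_neg (by positivity), one_div_one_div, Int.fract_natCast_add]
  exact Int.fract_eq_self.2 ⟨h0.le, h1⟩

theorem skewProd_neg {n : ℕ} {x y : ℝ} (hn : 1 ≤ n) (h0 : 0 < x) (h1 : x < 1) (hy : 0 ≤ y) :
    skewProd (1 / (n + x), -y) = (x, y) := by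
  have hpos : (0 : ℝ) < n + x := by positivity
  have hne : 1 / ((n : ℝ) + x) ≠ 0 := by positivity
  simp only [skewProd, gaussMap_one_div hn h0 h1, fiberMap, if_neg hne]
  rw [if_pos (by linarith), neg_neg]

theorem skewProd_toRect_branch {s : Bool} {n m : ℕ} {u : ℝ × ℝ} (hd : IsDigit s n m)
    (hu : u ∈ cell (nextState s m)) : skewProd (toRect (branch n m u)) = toRect u := by
  have hmem := branch_mem hd hu
  obtain ⟨hn, hm, hs⟩ := hd
  have hx0 := fst_pos hu
  have hx1 := fst_lt_one hu
  have hpos : (0 : ℝ) < n + u.1 := by positivity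
  have hne : 1 / ((n : ℝ) + u.1) ≠ 0 := by positivity
  cases s
  · obtain rfl := hs rfl
    have hu' : u ∈ cell true := hu
    rw [toRect_of_mem_false hmem, toRect_of_mem_true hu']
    have : ((branch n 0 u).1, (branch n 0 u).2 / (branch n 0 u).1) = (1 / (n + u.1), -u.2) := by
      simp only [branch]
      ext
      · simp
      · simp; field_simp
    rw [this, skewProd_neg hn hx0 hx1 hu'.2.2.1.le]
  · rw [toRect_of_mem_true hmem]
    have hα : ¬ (branch n m u).2 ≤ 0 := not_le.2 hmem.2.2.1
    rcases Nat.eq_zero_or_pos m with rfl | hmpos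
    · have hu' : u ∈ cell false := hu
      rw [toRect_of_mem_false hu']
      obtain ⟨-, -, h2, h3⟩ := hu'
      simp only [skewProd, fiberMap, if_neg hα]
      simp only [branch, gaussMap_one_div hn hx0 hx1, if_neg hne]
      rw [if_pos]
      · ext
        · rfl
        · simp; field_simp
      · rw [one_div_mul_eq_div, div_le_div_iff_of_pos_right hpos]
        simp; linarith
    · rw [nextState, if_neg hmpos.ne'] at hu
      rw [toRect_of_mem_true hu]
      obtain ⟨-, -, h2, h3⟩ := hu
      have hm1 : (1 : ℝ) ≤ m := by exact_mod_cast hmpos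
      simp only [skewProd, fiberMap, if_neg hα]
      simp only [branch, gaussMap_one_div hn hx0 hx1, if_neg hne, if_neg hmpos.ne']
      rw [if_neg]
      · ext
        · rfl
        · simp only
          rw [Int.fract_eq_iff]
          refine ⟨h2.le, h3, (n : ℤ) - m, ?_⟩
          push_cast
          field_simp
          ring
      · rw [one_div_mul_eq_div, div_le_div_iff_of_pos_right hpos]
        linarith

theorem branch_inj {s : Bool} {n m n' m' : ℕ} {u v : ℝ × ℝ} (hd : IsDigit s n m)
    (hd' : IsDigit s n' m') (hu : u ∈ cell (nextState s m)) (hv : v ∈ cell (nextState s m'))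
    (h : branch n m u = branch n' m' v) : n = n' ∧ m = m' ∧ u = v := by
  have huv : u = v := by
    refine toRect_injOn (fst_pos hu) (fst_pos hv) ?_
    rw [← skewProd_toRect_branch hd hu, ← skewProd_toRect_branch hd' hv, h]
  subst huv
  have hx0 := fst_pos hu
  have hpos : (0 : ℝ) < n + u.1 := by positivity
  have hpos' : (0 : ℝ) < n' + u.1 := by positivity
  simp only [branch, Prod.mk.injEq] at h
  obtain ⟨h1, h2⟩ := h
  rw [div_eq_div_iff hpos.ne' hpos'.ne'] at h1
  have hn : n = n' := by
    have : (n : ℝ) = n' := by linarith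
    exact_mod_cast this
  subst hn
  rw [div_left_inj' hpos.ne'] at h2
  refine ⟨rfl, ?_, rfl⟩
  have hmm : (0 : ℝ) ≤ m := m.cast_nonneg
  have hmm' : (0 : ℝ) ≤ m' := m'.cast_nonneg
  split_ifs at h2 with h3 h4 h4
  · rw [h3, h4]
  · rw [h3, Nat.cast_zero] at h2; linarith
  · rw [h4, Nat.cast_zero] at h2; linarith
  · have : (m : ℝ) = m' := by linarith
    exact_mod_cast this

/-- The lines which the inverse branches leave out. -/
def resonant : Set (ℝ × ℝ) := ⋃ k : ℤ, ({u | k * u.1 + 0 * u.2 = 1} ∪ {u | -k * u.1 + 1 * u.2 = 1})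

theorem volume_resonant : volume resonant = 0 := by
  refine measure_iUnion_null fun k => measure_union_null ?_ (volume_line (Or.inr one_ne_zero) 1)
  by_cases hk : (k : ℝ) = 0
  · simp [hk]
  · exact volume_line (Or.inl hk) 1

theorem exists_one_div_eq {x : ℝ} (h0 : 0 < x) (h1 : x < 1) (hx : ∀ k : ℤ, k * x ≠ 1) :
    ∃ n : ℕ, 1 ≤ n ∧ ∃ t : ℝ, 0 < t ∧ t < 1 ∧ x = 1 / (n + t) := by
  have hinv : 1 ≤ 1 / x := by rw [le_div_iff₀ h0]; linarith
  refine ⟨⌊1 / x⌋₊, Nat.le_floor (by simpa using hinv), 1 / x - ⌊1 / x⌋₊, ?_, ?_, ?_⟩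
  · have hle := Nat.floor_le (zero_le_one.trans hinv)
    refine sub_pos.2 (lt_of_le_of_ne hle fun h => hx ⌊1 / x⌋₊ ?_)
    push_cast
    rw [h]; field_simp
  · linarith [Nat.lt_floor_add_one (1 / x)]
  · rw [add_sub_cancel, one_div_one_div]

theorem exists_branch {s : Bool} {u : ℝ × ℝ} (hu : u ∈ cell s) (hr : u ∉ resonant) :
    ∃ n m : ℕ, IsDigit s n m ∧ ∃ v ∈ cell (nextState s m), branch n m v = u := by
  have hr1 : ∀ k : ℤ, k * u.1 ≠ 1 := fun k hk =>
    hr (mem_iUnion.2 ⟨k, Or.inl (by simpa using hk)⟩)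
  have hr2 : ∀ k : ℤ, u.2 ≠ 1 + k * u.1 := fun k hk =>
    hr (mem_iUnion.2 ⟨k, Or.inr (by simp only [mem_ofPred_eq]; linarith)⟩)
  obtain ⟨n, hn, t, ht0, ht1, hx⟩ := exists_one_div_eq (fst_pos hu) (fst_lt_one hu) hr1
  have hpos : (0 : ℝ) < n + t := by positivity
  obtain ⟨x, y⟩ := u
  simp only at hx hr1 hr2
  subst hx
  cases s
  · obtain ⟨-, -, h2, h3⟩ := hu
    simp only at h2 h3
    refine ⟨n, 0, ⟨hn, n.zero_le, fun _ => rfl⟩, (t, -y * (n + t)), ⟨ht0, ht1, ?_, ?_⟩, ?_⟩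
    · exact mul_pos (by linarith) hpos
    · rw [← neg_div, div_lt_iff₀ hpos] at h2
      simp only; linarith
    · simp only [branch]
      ext
      · rfl
      · simp; field_simp
  · obtain ⟨-, -, h2, h3⟩ := hu
    simp only at h2 h3
    have h3' : y * (n + t) < n + t := by nlinarith
    rcases lt_or_ge (y * (n + t)) t with hlt | hge
    · refine ⟨n, 0, ⟨hn, n.zero_le, fun h => by simp at h⟩, (t, -y * (n + t)),
        ⟨ht0, ht1, ?_, ?_⟩, ?_⟩
      · simp only; linarith
      · simp only; nlinarith
      · simp only [branch]
        ext
        · rfl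
        · simp; field_simp
    · have hne : ∀ j : ℕ, y * (n + t) - t ≠ j := by
        intro j hj
        apply hr2 (j - n)
        push_cast
        field_simp
        linarith
      have hgt : 0 < y * (n + t) - t :=
        lt_of_le_of_ne (by linarith) fun h => hne 0 (by rw [← h]; simp)
      have hc1 := Nat.le_ceil (y * (n + t) - t)
      have hc2 := Nat.ceil_lt_add_one hgt.le
      have hc0 : ⌈y * (n + t) - t⌉₊ ≠ 0 := (Nat.ceil_pos.2 hgt).ne'
      have hc3 : ⌈y * (n + t) - t⌉₊ ≤ n := Nat.ceil_le.2 (by linarith)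
      have hc4 : y * (n + t) - t < ⌈y * (n + t) - t⌉₊ := lt_of_le_of_ne hc1 (hne _)
      generalize ⌈y * (n + t) - t⌉₊ = m at *
      refine ⟨n, m, ⟨hn, hc3, fun h => by simp at h⟩, (t, m + t - y * (n + t)), ?_, ?_⟩
      · rw [nextState, if_neg hc0]
        exact ⟨ht0, ht1, by simp only; linarith, by simp only; linarith⟩
      · simp only [branch, if_neg hc0]
        ext
        · rfl
        · simp only; field_simp; ring

theorem ProjMap.Admissible.next_toFun {M : ProjMap} {k n : ℕ} (h : M.Admissible k) (hn : 1 ≤ n)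
    (m : ℕ) {u : ℝ × ℝ} (hu : 0 ≤ u.1) : (M.next n m).toFun u = M.toFun (branch n m u) := by
  have hpos : (0 : ℝ) < n + u.1 := by positivity
  have hq := h.one_le
  have hq' := h.nonneg
  have hn' : (1 : ℝ) ≤ n := by exact_mod_cast hn
  have h1 : (0 : ℝ) < M.q₀ * n + M.q₁ + M.q₀ * u.1 := by positivity
  have h2 : (0 : ℝ) < M.q₀ + M.q₁ * (1 / (n + u.1)) := by positivity
  simp only [ProjMap.toFun, ProjMap.next, branch]
  ext
  · simp only
    rw [div_eq_div_iff h1.ne' h2.ne']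
    field_simp
    ring
  · simp only
    rw [div_eq_div_iff h1.ne' h2.ne']
    field_simp
    ring

/-- The inverse branches of rank `k` of the rescaled skew product that land in the upper unit
square, together with the cell on which they are defined. -/
inductive IsInverseBranch : ℕ → Bool → ProjMap → Prop
  | zero : IsInverseBranch 0 true ProjMap.ident
  | step {k : ℕ} {s : Bool} {M : ProjMap} {n m : ℕ} :
      IsInverseBranch k s M → IsDigit s n m →
        IsInverseBranch (k + 1) (nextState s m) (M.next n m)

namespace IsInverseBranch

variable {k : ℕ} {s : Bool} {M : ProjMap}

theorem admissible (h : IsInverseBranch k s M) : M.Admissible k := by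
  induction h with
  | zero => exact ProjMap.admissible_ident
  | step _ hd ih => exact ih.next hd.1 hd.2.1

/-- A set stable under the one-step inverse branches is stable under those of all ranks. -/
theorem mem_of_stable {A : Set (ℝ × ℝ)}
    (hA : ∀ s n m, IsDigit s n m → ∀ u ∈ cell (nextState s m), u ∈ A → branch n m u ∈ A)
    (h : IsInverseBranch k s M) : ∀ u ∈ cell s, u ∈ A → M.toFun u ∈ A := by
  induction h with
  | zero => intro u _ hu; rwa [ProjMap.ident_toFun]
  | step h hd ih =>
    intro u hu huA
    rw [h.admissible.next_toFun hd.1 _ (fst_pos hu).le]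
    exact ih _ (branch_mem hd hu) (hA _ _ _ hd u hu huA)

theorem eq_of_toFun_eq : ∀ {k : ℕ} {s s' : Bool} {M M' : ProjMap} (_ : IsInverseBranch k s M)
    (_ : IsInverseBranch k s' M') {u v : ℝ × ℝ} (_ : u ∈ cell s) (_ : v ∈ cell s')
    (_ : M.toFun u = M'.toFun v), s = s' ∧ M = M' ∧ u = v := by
  intro k
  induction k with
  | zero =>
    intro s s' M M' h h' u v hu hv huv
    cases h
    cases h'
    simp only [ProjMap.ident_toFun] at huv
    exact ⟨rfl, rfl, huv⟩
  | succ k ih =>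
    intro s s' M M' h h' u v hu hv huv
    cases h with
    | step h hd =>
    cases h' with
    | step h' hd' =>
    rw [h.admissible.next_toFun hd.1 _ (fst_pos hu).le,
      h'.admissible.next_toFun hd'.1 _ (fst_pos hv).le] at huv
    obtain ⟨rfl, rfl, hb⟩ := ih h h' (branch_mem hd hu) (branch_mem hd' hv) huv
    obtain ⟨rfl, rfl, rfl⟩ := branch_inj hd hd' hu hv hb
    exact ⟨rfl, rfl, rfl⟩

end IsInverseBranch

theorem countable_isInverseBranch (k : ℕ) :
    {b : Bool × ProjMap | IsInverseBranch k b.1 b.2}.Countable := by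
  induction k with
  | zero =>
    refine (countable_singleton (true, ProjMap.ident)).mono ?_
    rintro ⟨s, M⟩ h
    cases h
    rfl
  | succ k ih =>
    refine ((ih.prod (countable_univ (α := ℕ × ℕ))).image
      fun d => (nextState d.1.1 d.2.2, d.1.2.next d.2.1 d.2.2)).mono ?_
    rintro ⟨s, M⟩ h
    cases h with
    | @step _ s M n m h hd => exact ⟨((s, M), (n, m)), ⟨h, mem_univ _⟩, rfl⟩

/-- The cylinders of rank `k` in the upper unit square. -/
def cylinders (k : ℕ) : Set (Set (ℝ × ℝ)) :=
  (fun b : Bool × ProjMap => b.2.toFun '' cell b.1) '' {b | IsInverseBranch k b.1 b.2}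

theorem pairwiseDisjoint_cylinders (k : ℕ) : (cylinders k).PairwiseDisjoint id := by
  rintro _ ⟨⟨s, M⟩, h, rfl⟩ _ ⟨⟨s', M'⟩, h', rfl⟩ hne
  rw [Function.onFun, Set.disjoint_left]
  rintro _ ⟨u, hu, rfl⟩ ⟨v, hv, huv⟩
  obtain ⟨rfl, rfl, -⟩ := IsInverseBranch.eq_of_toFun_eq h h' hu hv huv.symm
  exact hne rfl

theorem volume_cell_diff_cylinders (k : ℕ) : volume (cell true \ ⋃₀ cylinders k) = 0 := by
  induction k with
  | zero =>
    have : cell true ⊆ ⋃₀ cylinders 0 := fun u hu =>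
      ⟨_, ⟨(true, ProjMap.ident), .zero, rfl⟩, u, hu, ProjMap.ident_toFun u⟩
    rw [sdiff_eq_empty.2 this, measure_empty]
  | succ k ih =>
    have hsub : cell true \ ⋃₀ cylinders (k + 1) ⊆ (cell true \ ⋃₀ cylinders k) ∪
        ⋃ b ∈ {b : Bool × ProjMap | IsInverseBranch k b.1 b.2},
          b.2.toFun '' (cell b.1 ∩ resonant) := by
      rintro p ⟨hp, hp'⟩
      by_cases hk : p ∈ ⋃₀ cylinders k
      · right
        obtain ⟨_, ⟨⟨s, M⟩, h, rfl⟩, u, hu, rfl⟩ := hk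
        have h : IsInverseBranch k s M := h
        refine mem_biUnion (x := (s, M)) h ⟨u, ⟨hu, ?_⟩, rfl⟩
        by_contra hr
        obtain ⟨n, m, hd, v, hv, rfl⟩ := exists_branch hu hr
        exact hp' ⟨_, ⟨(nextState s m, M.next n m), h.step hd, rfl⟩, v, hv,
          h.admissible.next_toFun hd.1 m (fst_pos hv).le⟩
      · exact Or.inl ⟨hp, hk⟩
    refine measure_mono_null hsub (measure_union_null ih ?_)
    refine (measure_biUnion_null_iff (countable_isInverseBranch k)).2 fun b hb => ?_
    have hb : IsInverseBranch k b.1 b.2 := hb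
    refine addHaar_image_eq_zero_of_differentiableOn_of_addHaar_eq_zero volume
      (fun u hu => ?_) (measure_mono_null inter_subset_right volume_resonant)
    exact (ProjMap.hasFDerivAt_toFun
      (hb.admissible.denom_pos (fst_pos hu.1).le).ne').differentiableAt.differentiableWithinAt

/-- A measurable set stable under the inverse branches which meets both cells in positive measure
has full measure in the upper unit square. -/
theorem volume_cell_diff_of_stable {A : Set (ℝ × ℝ)} (hAm : MeasurableSet A)
    (hA : ∀ s n m, IsDigit s n m → ∀ u ∈ cell (nextState s m), u ∈ A → branch n m u ∈ A)
    (hpos : ∀ s, volume (cell s ∩ A) ≠ 0) : volume (cell true \ A) = 0 := by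
  set c : ENNReal :=
    ENNReal.ofReal (1 / 8) * min (volume (cell true ∩ A)) (volume (cell false ∩ A))
  have hc_le : ∀ s, c ≤ ENNReal.ofReal (1 / 8) * volume (cell s ∩ A) := by
    intro s
    refine mul_le_mul_right ?_ _
    cases s
    · exact min_le_right _ _
    · exact min_le_left _ _
  have hδ : Tendsto (fun k : ℕ => (14 : ℝ) / ((k : ℝ) + 1)) atTop (𝓝 0) :=
    tendsto_const_nhds.div_atTop (tendsto_atTop_add_const_right _ _ tendsto_natCast_atTop_atTop)
  refine measure_eq_zero_of_fine_partitions volume (𝒞 := cylinders) (c := c) hδ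
    (fun k => (countable_isInverseBranch k).image _) pairwiseDisjoint_cylinders ?_ ?_
    ((measurableSet_cell true).diff hAm) ?_ ?_ ?_
  · rintro k _ ⟨⟨s, M⟩, h, rfl⟩
    exact h.admissible.measurableSet_image (measurableSet_cell s) fun u hu => (fst_pos hu).le
  · rintro k _ ⟨⟨s, M⟩, h, rfl⟩ _ ⟨u, hu, rfl⟩ _ ⟨v, hv, rfl⟩
    exact h.admissible.dist_le (cell_subset_rect s hu) (cell_subset_rect s hv)
  · intro k
    exact measure_mono_null (sdiff_subset_sdiff_left sdiff_subset) (volume_cell_diff_cylinders k)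
  · refine mul_ne_zero (by norm_num) ?_
    rw [← pos_iff_ne_zero]
    exact lt_min (pos_iff_ne_zero.2 (hpos true)) (pos_iff_ne_zero.2 (hpos false))
  · rintro k _ ⟨⟨s, M⟩, h, rfl⟩
    have h : IsInverseBranch k s M := h
    have hsub : M.toFun '' (cell s ∩ A) ⊆ (M.toFun '' cell s) \ (cell true \ A) := by
      rintro _ ⟨u, ⟨hu, huA⟩, rfl⟩
      exact ⟨⟨u, hu, rfl⟩, fun h' => h'.2 (h.mem_of_stable hA u hu huA)⟩
    calc c * volume (M.toFun '' cell s)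
        ≤ ENNReal.ofReal (1 / 8) * volume (cell s ∩ A) * (ENNReal.ofReal (1 / M.q₀ ^ 3) * 1) := by
          refine mul_le_mul' (hc_le s) ?_
          exact (h.admissible.volume_image_le (measurableSet_cell s)
            fun u hu => (fst_pos hu).le).trans (mul_le_mul_right (volume_cell_le s) _)
      _ = ENNReal.ofReal (1 / 8) * ENNReal.ofReal (1 / M.q₀ ^ 3) * volume (cell s ∩ A) := by ring
      _ ≤ volume (M.toFun '' (cell s ∩ A)) :=
          h.admissible.le_volume_image ((measurableSet_cell s).inter hAm)
            (fun u hu => (fst_pos hu.1).le) fun u hu => (fst_lt_one hu.1).le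
      _ ≤ _ := measure_mono hsub

/-- The inverse branch exchanging the two cells carries positive measure from one to the other. -/
theorem volume_cell_inter_ne_zero_of_not {A : Set (ℝ × ℝ)} (hAm : MeasurableSet A)
    (hA : ∀ s n m, IsDigit s n m → ∀ u ∈ cell (nextState s m), u ∈ A → branch n m u ∈ A)
    {s : Bool} (h : volume (cell (!s) ∩ A) ≠ 0) : volume (cell s ∩ A) ≠ 0 := by
  have hd : IsDigit s 1 0 := ⟨le_rfl, zero_le_one, fun _ => rfl⟩
  have hM : (ProjMap.ident.next 1 0).Admissible (0 + 1) :=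
    ProjMap.admissible_ident.next le_rfl zero_le_one
  have hsub : (ProjMap.ident.next 1 0).toFun '' (cell (!s) ∩ A) ⊆ cell s ∩ A := by
    rintro _ ⟨u, ⟨hu, huA⟩, rfl⟩
    rw [ProjMap.admissible_ident.next_toFun le_rfl 0 (fst_pos hu).le, ProjMap.ident_toFun]
    exact ⟨branch_mem hd hu, hA s 1 0 hd u hu huA⟩
  have hle := (hM.le_volume_image ((measurableSet_cell (!s)).inter hAm)
    (fun u hu => (fst_pos hu.1).le) fun u hu => (fst_lt_one hu.1).le).trans (measure_mono hsub)
  refine fun h0 => absurd (hle.trans_eq h0) (not_le.2 (pos_iff_ne_zero.2 ?_))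
  refine mul_ne_zero (mul_ne_zero (by norm_num) ?_) h
  have := hM.one_le
  exact (ENNReal.ofReal_pos.2 (by positivity)).ne'

/-- The boundary lines of the two halves of the rectangle. -/
def boundaryLines : Set (ℝ × ℝ) :=
  {u | 1 * u.1 + 0 * u.2 = 0} ∪ {u | 0 * u.1 + 1 * u.2 = -1} ∪ {u | 0 * u.1 + 1 * u.2 = 0} ∪
    {u | 0 * u.1 + 1 * u.2 = 1}

theorem volume_boundaryLines : volume boundaryLines = 0 := by
  refine measure_union_null (measure_union_null (measure_union_null ?_ ?_) ?_) ?_ <;>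
    exact volume_line (by simp) _

theorem mem_rect_cases {u : ℝ × ℝ} (hu : u ∈ Rect) (hb : u ∉ boundaryLines ∪ resonant) :
    u ∈ cell true ∨ (0 < u.1 ∧ u.1 < 1 ∧ -1 < u.2 ∧ u.2 < 0) := by
  obtain ⟨⟨h1, h2⟩, h3, h4⟩ := hu
  simp only [boundaryLines, mem_union, mem_ofPred_eq, zero_mul, one_mul, add_zero, zero_add,
    not_or] at hb
  obtain ⟨⟨⟨⟨b1, b2⟩, b3⟩, b4⟩, hr⟩ := hb
  have b5 : u.1 ≠ 1 := fun h => hr (mem_iUnion.2 ⟨1, Or.inl (by simp [h])⟩)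
  have h1' : 0 < u.1 := lt_of_le_of_ne h1 (Ne.symm b1)
  have h2' : u.1 < 1 := lt_of_le_of_ne h2 b5
  have h3' : -1 < u.2 := lt_of_le_of_ne h3 (Ne.symm b2)
  have h4' : u.2 < 1 := lt_of_le_of_ne h4 b4
  rcases lt_or_gt_of_ne b3 with h | h
  · exact Or.inr ⟨h1', h2', h3', h⟩
  · exact Or.inl ⟨h1', h2', h, h4'⟩

theorem measurable_skewProd : Measurable skewProd := by
  have hg : Measurable gaussMap := by
    unfold gaussMap
    exact Measurable.ite (measurableSet_eq_fun measurable_id measurable_const) measurable_const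
      (Measurable.fract (by fun_prop))
  refine (hg.comp measurable_fst).prodMk ?_
  unfold fiberMap
  have hg' : Measurable fun p : ℝ × ℝ => gaussMap p.1 := hg.comp measurable_fst
  refine Measurable.ite (measurableSet_eq_fun measurable_fst measurable_const) measurable_const ?_
  refine Measurable.ite (measurableSet_le measurable_snd measurable_const) (by fun_prop) ?_
  refine Measurable.ite (measurableSet_le measurable_snd (by fun_prop)) (by fun_prop) ?_
  exact Measurable.fract (by fun_prop)

/-- A measurable set of positive measure in the rectangle containing its own preimage under the
skew product has full measure. -/
theorem volume_rect_diff_of_preimage_subset {E : Set (ℝ × ℝ)} (hEm : MeasurableSet E)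
    (hE : skewProd ⁻¹' E ⊆ E) (hpos : volume (Rect ∩ E) ≠ 0) : volume (Rect \ E) = 0 := by
  have hAm : MeasurableSet (toRect ⁻¹' E) := measurable_toRect hEm
  have hA : ∀ s n m, IsDigit s n m → ∀ u ∈ cell (nextState s m), u ∈ toRect ⁻¹' E →
      branch n m u ∈ toRect ⁻¹' E := by
    intro s n m hd u hu huE
    apply hE
    rw [mem_preimage, skewProd_toRect_branch hd hu]
    exact huE
  have hnull : volume (boundaryLines ∪ resonant) = 0 :=
    measure_union_null volume_boundaryLines volume_resonant
  have hsome : ∃ s, volume (cell s ∩ toRect ⁻¹' E) ≠ 0 := by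
    by_contra! hzero
    have hsub : Rect ∩ E ⊆ (boundaryLines ∪ resonant) ∪ (cell true ∩ toRect ⁻¹' E) ∪
        (fun u : ℝ × ℝ => (u.1, u.2 / u.1)) '' (cell false ∩ toRect ⁻¹' E) := by
      rintro u ⟨hu, huE⟩
      by_cases hb : u ∈ boundaryLines ∪ resonant
      · exact Or.inl (Or.inl hb)
      rcases mem_rect_cases hu hb with h | ⟨h1, h2, h3, h4⟩
      · refine Or.inl (Or.inr ⟨h, ?_⟩)
        rwa [mem_preimage, toRect_of_mem_true h]
      · have heq : (u.1, u.2 * u.1 / u.1) = u := by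
          rw [mul_div_cancel_right₀ _ h1.ne']
        have hcell : (u.1, u.2 * u.1) ∈ cell false :=
          ⟨h1, h2, by simp only; nlinarith, mul_neg_of_neg_of_pos h4 h1⟩
        refine Or.inr ⟨(u.1, u.2 * u.1), ⟨hcell, ?_⟩, heq⟩
        rwa [mem_preimage, toRect_of_mem_false hcell, heq]
    refine hpos (measure_mono_null hsub (measure_union_null
      (measure_union_null hnull (hzero true)) ?_))
    refine addHaar_image_eq_zero_of_differentiableOn_of_addHaar_eq_zero volume
      (fun u hu => ?_) (hzero false)
    have := (fst_pos hu.1).ne'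
    exact DifferentiableAt.differentiableWithinAt (by fun_prop (disch := assumption))
  have hall : ∀ s, volume (cell s ∩ toRect ⁻¹' E) ≠ 0 := by
    obtain ⟨s, hs⟩ := hsome
    intro t
    by_cases hts : t = s
    · rwa [hts]
    · refine volume_cell_inter_ne_zero_of_not hAm hA ?_
      rwa [Bool.not_eq.2 hts]
  have hupper := volume_cell_diff_of_stable hAm hA hall
  have hsub : Rect \ E ⊆ (boundaryLines ∪ resonant) ∪ (cell true \ toRect ⁻¹' E) ∪
      ⋃ n : ℕ, (fun u : ℝ × ℝ => (1 / ((n : ℝ) + u.1), -u.2)) '' (cell true \ toRect ⁻¹' E) := by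
    rintro u ⟨hu, huE⟩
    by_cases hb : u ∈ boundaryLines ∪ resonant
    · exact Or.inl (Or.inl hb)
    rcases mem_rect_cases hu hb with h | ⟨h1, h2, h3, h4⟩
    · refine Or.inl (Or.inr ⟨h, ?_⟩)
      rwa [mem_preimage, toRect_of_mem_true h]
    · have hr : ∀ k : ℤ, k * u.1 ≠ 1 := fun k hk =>
        hb (Or.inr (mem_iUnion.2 ⟨k, Or.inl (by simpa using hk)⟩))
      obtain ⟨n, hn, t, ht0, ht1, hx⟩ := exists_one_div_eq h1 h2 hr
      have heq : (1 / ((n : ℝ) + t), - -u.2) = u := by rw [← hx, neg_neg]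
      have hcell : (t, -u.2) ∈ cell true :=
        ⟨ht0, ht1, by simp only; linarith, by simp only; linarith⟩
      refine Or.inr (mem_iUnion.2 ⟨n, (t, -u.2), ⟨hcell, fun hmem => huE (hE ?_)⟩, heq⟩)
      rw [mem_preimage, toRect_of_mem_true hcell] at hmem
      rw [mem_preimage, ← heq, skewProd_neg hn ht0 ht1 (by linarith)]
      exact hmem
  refine measure_mono_null hsub (measure_union_null (measure_union_null hnull hupper)
    (measure_iUnion_null fun n => ?_))
  refine addHaar_image_eq_zero_of_differentiableOn_of_addHaar_eq_zero volume
    (fun u hu => ?_) hupper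
  have hu0 := fst_pos hu.1
  have : (n : ℝ) + u.1 ≠ 0 := by positivity
  exact DifferentiableAt.differentiableWithinAt (by fun_prop (disch := assumption))

end SkewProduct

/-- **Lemma A.9.** If `B ⊆ R` is a Borel set of positive Lebesgue measure, then
`R ∖ ⋃_{n≥0} T⁻ⁿ(B)` has Lebesgue measure zero. -/
theorem fullPreimages (B : Set (ℝ × ℝ)) (hB : B ⊆ Rect) (hBm : MeasurableSet B)
    (hpos : 0 < volume B) :
    volume (Rect \ ⋃ n : ℕ, skewProd^[n] ⁻¹' B) = 0 := by
  refine SkewProduct.volume_rect_diff_of_preimage_subset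
    (MeasurableSet.iUnion fun n => SkewProduct.measurable_skewProd.iterate n hBm) ?_ ?_
  · intro p hp
    obtain ⟨n, hn⟩ := mem_iUnion.1 hp
    refine mem_iUnion.2 ⟨n + 1, ?_⟩
    rwa [mem_preimage, Function.iterate_succ_apply]
  · have hsub : B ⊆ Rect ∩ ⋃ n : ℕ, skewProd^[n] ⁻¹' B :=
      fun p hp => ⟨hB hp, mem_iUnion.2 ⟨0, hp⟩⟩
    exact (hpos.trans_le (measure_mono hsub)).ne'
end
end

section
/- If A⊆R is a Borel set that is strongly invariant under T (i.e., T^{−1}(A)=A) and has positive Lebesgue measure, then R∖A has Lebesgue measure zero. -/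
noncomputable section

open Set Filter MeasureTheory Topology

/-- The open unit square. -/
def openSquare : Set (ℝ × ℝ) := Ioo (0 : ℝ) 1 ×ˢ Ioo (0 : ℝ) 1

/-- The closed unit square. -/
def closedSquare : Set (ℝ × ℝ) := Icc (0 : ℝ) 1 ×ˢ Icc (0 : ℝ) 1

lemma openSquare_subset_closedSquare : openSquare ⊆ closedSquare :=
  prod_mono Ioo_subset_Icc_self Ioo_subset_Icc_self

lemma measurableSet_openSquare : MeasurableSet openSquare :=
  measurableSet_Ioo.prod measurableSet_Ioo

lemma volume_openSquare : volume openSquare = 1 := by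
  simp [openSquare, Measure.volume_eq_prod]

/-- Unimodular projective maps `(x, y) ↦ ((a x + b) / (c x + d), (u x + v y + w) / (c x + d))`
whose denominator varies at most by a factor `2` over the unit square. -/
structure ProjBranch where
  (a b c d u v w : ℝ)
  one_le_d : 1 ≤ d
  c_nonneg : 0 ≤ c
  c_le_d : c ≤ d
  abs_det : |a * d - b * c| = 1
  abs_v : |v| = 1

namespace ProjBranch

variable (f : ProjBranch)

/-- The map defined by the coefficients of a `ProjBranch`. -/
def toMap (z : ℝ × ℝ) : ℝ × ℝ :=
  ((f.a * z.1 + f.b) / (f.c * z.1 + f.d), (f.u * z.1 + f.v * z.2 + f.w) / (f.c * z.1 + f.d))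

lemma le_denom {x : ℝ} (hx : 0 ≤ x) : f.d ≤ f.c * x + f.d := by
  have := mul_nonneg f.c_nonneg hx
  linarith

lemma denom_pos {x : ℝ} (hx : 0 ≤ x) : 0 < f.c * x + f.d := by
  linarith [f.le_denom hx, f.one_le_d]

lemma denom_le {x : ℝ} (hx : x ≤ 1) : f.c * x + f.d ≤ 2 * f.d := by
  have := mul_le_of_le_one_right f.c_nonneg hx
  linarith [f.c_le_d]

lemma fst_sub_fst {z z' : ℝ × ℝ} (hz : 0 ≤ z.1) (hz' : 0 ≤ z'.1) :
    |(f.toMap z).1 - (f.toMap z').1| =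
      |z.1 - z'.1| / ((f.c * z.1 + f.d) * (f.c * z'.1 + f.d)) := by
  have h := f.denom_pos hz
  have h' := f.denom_pos hz'
  have : (f.toMap z).1 - (f.toMap z').1 =
      (f.a * f.d - f.b * f.c) * (z.1 - z'.1) / ((f.c * z.1 + f.d) * (f.c * z'.1 + f.d)) := by
    simp only [toMap]
    rw [div_sub_div _ _ h.ne' h'.ne']
    ring
  rw [this, abs_div, abs_mul, f.abs_det, one_mul, abs_of_pos (mul_pos h h')]

lemma snd_sub_snd {z z' : ℝ × ℝ} (hz : 0 ≤ z.1) (h : z.1 = z'.1) :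
    |(f.toMap z).2 - (f.toMap z').2| = |z.2 - z'.2| / (f.c * z.1 + f.d) := by
  have hp := f.denom_pos hz
  have : (f.toMap z).2 - (f.toMap z').2 = f.v * (z.2 - z'.2) / (f.c * z.1 + f.d) := by
    simp only [toMap, ← h]
    field_simp
    ring
  rw [this, abs_div, abs_mul, f.abs_v, one_mul, abs_of_pos hp]

lemma fst_eq_of_map_fst_eq {z z' : ℝ × ℝ} (hz : 0 ≤ z.1) (hz' : 0 ≤ z'.1)
    (h : (f.toMap z).1 = (f.toMap z').1) : z.1 = z'.1 := by
  have h1 := f.fst_sub_fst hz hz'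
  have hp := mul_pos (f.denom_pos hz) (f.denom_pos hz')
  rw [h, sub_self, abs_zero, eq_comm, div_eq_zero_iff] at h1
  rcases h1 with h1 | h1
  · exact sub_eq_zero.1 (abs_eq_zero.1 h1)
  · exact absurd h1 hp.ne'

lemma injOn_closedSquare : InjOn f.toMap closedSquare := by
  rintro z ⟨hz, -⟩ z' ⟨hz', -⟩ h
  have h1 := f.fst_eq_of_map_fst_eq hz.1 hz'.1 (congrArg Prod.fst h)
  have h2 := f.snd_sub_snd hz.1 h1
  rw [h, sub_self, abs_zero, eq_comm, div_eq_zero_iff] at h2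
  rcases h2 with h2 | h2
  · exact Prod.ext h1 (sub_eq_zero.1 (abs_eq_zero.1 h2))
  · exact absurd h2 (f.denom_pos hz.1).ne'

/-- The derivative of a projective branch. -/
def deriv (z : ℝ × ℝ) : ℝ × ℝ →L[ℝ] ℝ × ℝ :=
  (Matrix.toLin (.finTwoProd ℝ) (.finTwoProd ℝ)
    !![(f.a * f.d - f.b * f.c) / (f.c * z.1 + f.d) ^ 2, 0;
      (f.u * f.d - f.c * (f.v * z.2 + f.w)) / (f.c * z.1 + f.d) ^ 2,
      f.v / (f.c * z.1 + f.d)]).toContinuousLinearMap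

lemma hasFDerivAt {z : ℝ × ℝ} (hz : 0 ≤ z.1) : HasFDerivAt f.toMap (f.deriv z) z := by
  have hp := (f.denom_pos hz).ne'
  have hx : HasFDerivAt (fun z : ℝ × ℝ => z.1) (ContinuousLinearMap.fst ℝ ℝ ℝ) z :=
    hasFDerivAt_fst
  have hy : HasFDerivAt (fun z : ℝ × ℝ => z.2) (ContinuousLinearMap.snd ℝ ℝ ℝ) z :=
    hasFDerivAt_snd
  have hden := (hx.const_mul f.c).add_const f.d
  have hinv := (hasDerivAt_inv hp).comp_hasFDerivAt z hden
  have h1 := ((hx.const_mul f.a).add_const f.b).mul hinv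
  have h2 := (((hx.const_mul f.u).add (hy.const_mul f.v)).add_const f.w).mul hinv
  unfold deriv
  rw [Matrix.toLin_finTwoProd_toContinuousLinearMap]
  refine (h1.prodMk h2).congr_fderiv ?_
  ext <;> simp <;> field_simp <;> ring

lemma abs_det_deriv {z : ℝ × ℝ} (hz : 0 ≤ z.1) :
    |(f.deriv z).det| = ((f.c * z.1 + f.d) ^ 3)⁻¹ := by
  have hp := f.denom_pos hz
  have : (f.deriv z).det = (f.a * f.d - f.b * f.c) * f.v * ((f.c * z.1 + f.d) ^ 3)⁻¹ := by
    simp only [deriv, ContinuousLinearMap.det, LinearMap.coe_toContinuousLinearMap,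
      LinearMap.det_toLin, Matrix.det_fin_two_of]
    field_simp
    ring
  rw [this, abs_mul, abs_mul, f.abs_det, f.abs_v, abs_of_pos (by positivity), one_mul, one_mul]

variable {f} {E : Set (ℝ × ℝ)}

lemma continuousOn_closedSquare : ContinuousOn f.toMap closedSquare :=
  fun _ hz => (f.hasFDerivAt hz.1.1).continuousAt.continuousWithinAt

lemma volume_image (hE : MeasurableSet E) (hsub : E ⊆ closedSquare) :
    volume (f.toMap '' E) = ∫⁻ z in E, ENNReal.ofReal (((f.c * z.1 + f.d) ^ 3)⁻¹) := by
  rw [← lintegral_abs_det_fderiv_eq_addHaar_image volume hE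
    (fun z hz => (f.hasFDerivAt (hsub hz).1.1).hasFDerivWithinAt) (f.injOn_closedSquare.mono hsub)]
  exact setLIntegral_congr_fun hE fun z hz => by rw [f.abs_det_deriv (hsub hz).1.1]

lemma volume_image_le (hE : MeasurableSet E) (hsub : E ⊆ closedSquare) :
    volume (f.toMap '' E) ≤ ENNReal.ofReal ((f.d ^ 3)⁻¹) * volume E := by
  rw [volume_image hE hsub, ← setLIntegral_const]
  refine setLIntegral_mono' hE fun z hz => ENNReal.ofReal_le_ofReal ?_
  have h0 : 0 < f.d := by linarith [f.one_le_d]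
  have := f.le_denom (hsub hz).1.1
  gcongr

lemma le_volume_image (hE : MeasurableSet E) (hsub : E ⊆ closedSquare) :
    ENNReal.ofReal ((f.d ^ 3)⁻¹) * volume E ≤ 8 * volume (f.toMap '' E) := by
  rw [volume_image hE hsub, ← setLIntegral_const, ← lintegral_const_mul' _ _ (by simp)]
  refine setLIntegral_mono' hE fun z hz => ?_
  have h0 : 0 < f.d := by linarith [f.one_le_d]
  have h1 := f.denom_le (hsub hz).1.2
  have h2 := f.denom_pos (hsub hz).1.1
  rw [show (8 : ENNReal) = ENNReal.ofReal 8 by simp, ← ENNReal.ofReal_mul (by norm_num)]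
  refine ENNReal.ofReal_le_ofReal ?_
  calc (f.d ^ 3)⁻¹ = 8 * ((2 * f.d) ^ 3)⁻¹ := by field_simp; norm_num
    _ ≤ 8 * ((f.c * z.1 + f.d) ^ 3)⁻¹ := by gcongr

lemma volume_mul_volume_image_openSquare_le (hE : MeasurableSet E) (hsub : E ⊆ openSquare) :
    volume E * volume (f.toMap '' openSquare) ≤ 8 * volume (f.toMap '' E) := by
  refine le_trans ?_ (le_volume_image hE (hsub.trans openSquare_subset_closedSquare))
  rw [mul_comm]
  gcongr
  simpa [volume_openSquare] using
    volume_image_le (f := f) measurableSet_openSquare openSquare_subset_closedSquare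

lemma measurableSet_image (hE : MeasurableSet E) (hsub : E ⊆ closedSquare) :
    MeasurableSet (f.toMap '' E) :=
  hE.image_of_continuousOn_injOn (continuousOn_closedSquare.mono hsub)
    (f.injOn_closedSquare.mono hsub)

lemma volume_image_eq_zero (hsub : E ⊆ closedSquare) (h0 : volume E = 0) :
    volume (f.toMap '' E) = 0 :=
  addHaar_image_eq_zero_of_differentiableOn_of_addHaar_eq_zero volume
    (fun _ hz => (f.hasFDerivAt (hsub hz).1.1).differentiableAt.differentiableWithinAt) h0

end ProjBranch

/-- The inverse branches of the first return map of the skew product to the unit square.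
The digit `inl (k, j)` inverts one step with partial quotient `k + j + 1` and integer part `k` in
the fiber; the digit `inr (i, j)` inverts two steps, with partial quotients `i + 1` and `j + 1`,
that pass through the lower half of the rectangle. -/
def invBranch : (ℕ × ℕ) ⊕ (ℕ × ℕ) → ℝ × ℝ → ℝ × ℝ
  | .inl (k, j), z => (1 / (z.1 + (k + j + 1)), (z.1 - z.2 + (j + 1)) / (z.1 + (k + j + 1)))
  | .inr (i, j), z => ((z.1 + (j + 1)) / ((i + 1) * (z.1 + (j + 1)) + 1),
      z.2 / ((i + 1) * (z.1 + (j + 1)) + 1))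

lemma invBranch_mapsTo_openSquare (e : (ℕ × ℕ) ⊕ (ℕ × ℕ)) :
    MapsTo (invBranch e) openSquare openSquare := by
  rintro ⟨x, y⟩ ⟨⟨hx0, hx1⟩, hy0, hy1⟩
  rcases e with ⟨k, j⟩ | ⟨k, j⟩ <;> simp only at hx0 hx1 hy0 hy1 <;>
    have hk : (0 : ℝ) ≤ k := k.cast_nonneg <;> have hj : (0 : ℝ) ≤ j := j.cast_nonneg
  · have h : 0 < x + (k + j + 1) := by positivity
    refine ⟨⟨by simp only [invBranch]; positivity, ?_⟩,
      div_pos (by linarith) h, ?_⟩ <;>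
    · simp only [invBranch]
      rw [div_lt_one h]
      linarith
  · have h : 0 < (k + 1) * (x + (j + 1)) + 1 := by positivity
    have h' : 0 ≤ k * (x + (j + 1)) := by positivity
    refine ⟨⟨by simp only [invBranch]; positivity, ?_⟩,
      by simp only [invBranch]; positivity, ?_⟩ <;>
    · simp only [invBranch]
      rw [div_lt_one h]
      linarith

lemma invBranch_mapsTo_closedSquare (e : (ℕ × ℕ) ⊕ (ℕ × ℕ)) :
    MapsTo (invBranch e) closedSquare closedSquare := by
  rintro ⟨x, y⟩ ⟨⟨hx0, hx1⟩, hy0, hy1⟩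
  rcases e with ⟨k, j⟩ | ⟨k, j⟩ <;> simp only at hx0 hx1 hy0 hy1 <;>
    have hk : (0 : ℝ) ≤ k := k.cast_nonneg <;> have hj : (0 : ℝ) ≤ j := j.cast_nonneg
  · have h : 0 < x + (k + j + 1) := by positivity
    refine ⟨⟨by simp only [invBranch]; positivity, ?_⟩,
      div_nonneg (by linarith) h.le, ?_⟩ <;>
    · simp only [invBranch]
      rw [div_le_one h]
      linarith
  · have h : 0 < (k + 1) * (x + (j + 1)) + 1 := by positivity
    have h' : 0 ≤ k * (x + (j + 1)) := by positivity
    refine ⟨⟨by simp only [invBranch]; positivity, ?_⟩,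
      by simp only [invBranch]; positivity, ?_⟩ <;>
    · simp only [invBranch]
      rw [div_le_one h]
      linarith

lemma ProjBranch.exists_comp_invBranch (f : ProjBranch) (e : (ℕ × ℕ) ⊕ (ℕ × ℕ)) :
    ∃ g : ProjBranch, f.c + f.d + 1 ≤ g.c + g.d ∧
      ∀ z : ℝ × ℝ, 0 ≤ z.1 → f.toMap (invBranch e z) = g.toMap z := by
  have hd := f.one_le_d
  have hc := f.c_nonneg
  have hcd := f.c_le_d
  rcases e with ⟨k, j⟩ | ⟨k, j⟩ <;>
    have hk : (0 : ℝ) ≤ k := k.cast_nonneg <;> have hj : (0 : ℝ) ≤ j := j.cast_nonneg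
  · have h1 : 0 ≤ f.d * (k + j) := by positivity
    refine ⟨⟨f.b, f.a + f.b * (k + j + 1), f.d, f.c + f.d * (k + j + 1), f.v + f.w, -f.v,
      f.u + f.v * (j + 1) + f.w * (k + j + 1), by linarith, by linarith, by linarith, ?_,
      by rw [abs_neg, f.abs_v]⟩, by simp only; linarith, ?_⟩
    · rw [← abs_neg]
      convert f.abs_det using 2
      ring
    · rintro ⟨x, y⟩ hx
      simp only at hx
      have h : 0 < x + (k + j + 1) := by positivity
      simp only [ProjBranch.toMap, invBranch, Prod.mk.injEq]
      constructor
      · rw [← mul_div_mul_right _ (f.c * (1 / (x + (k + j + 1))) + f.d) h.ne']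
        congr 1 <;> field_simp <;> ring
      · rw [← mul_div_mul_right _ (f.c * (1 / (x + (k + j + 1))) + f.d) h.ne']
        congr 1 <;> field_simp <;> ring
  · have h1 : 0 ≤ f.d * k := by positivity
    have h2 : 0 ≤ f.c * j := by positivity
    have h3 : 0 ≤ f.d * k * j := by positivity
    have h4 : 0 ≤ f.d * j := by positivity
    refine ⟨⟨f.a + f.b * (k + 1), f.a * (j + 1) + f.b * ((k + 1) * (j + 1) + 1),
      f.c + f.d * (k + 1), f.c * (j + 1) + f.d * ((k + 1) * (j + 1) + 1),
      f.u + f.w * (k + 1), f.v, f.u * (j + 1) + f.w * ((k + 1) * (j + 1) + 1),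
      by linarith, by linarith, by linarith, ?_, f.abs_v⟩, by simp only; linarith, ?_⟩
    · convert f.abs_det using 2
      ring
    · rintro ⟨x, y⟩ hx
      simp only at hx
      have h : 0 < (k + 1) * (x + (j + 1)) + 1 := by positivity
      simp only [ProjBranch.toMap, invBranch, Prod.mk.injEq]
      constructor
      · rw [← mul_div_mul_right _ (f.c * ((x + (j + 1)) / ((k + 1) * (x + (j + 1)) + 1)) + f.d)
          h.ne']
        congr 1 <;> field_simp <;> ring
      · rw [← mul_div_mul_right _ (f.c * ((x + (j + 1)) / ((k + 1) * (x + (j + 1)) + 1)) + f.d)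
          h.ne']
        congr 1 <;> field_simp <;> ring

lemma gaussMap_one_div_add {x : ℝ} (h0 : 0 < x) (h1 : x < 1) (n : ℕ) :
    gaussMap (1 / (x + n)) = x := by
  have h : 0 < x + n := by positivity
  rw [gaussMap, if_neg (by positivity), one_div_one_div, Int.fract_add_natCast,
    Int.fract_eq_self.2 ⟨h0.le, h1⟩]

lemma skewProd_invBranch_inl (k j : ℕ) {z : ℝ × ℝ} (hz : z ∈ openSquare) :
    skewProd (invBranch (.inl (k, j)) z) = z := by
  obtain ⟨x, y⟩ := z
  obtain ⟨⟨hx0, hx1⟩, hy0, hy1⟩ := hz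
  simp only at hx0 hx1 hy0 hy1
  have hj : (0 : ℝ) ≤ j := j.cast_nonneg
  have hk : (0 : ℝ) ≤ k := k.cast_nonneg
  have h : 0 < x + (k + j + 1) := by positivity
  have hg : gaussMap (1 / (x + (k + j + 1))) = x := by
    simpa using gaussMap_one_div_add hx0 hx1 (k + j + 1)
  have hpos : 0 < (x - y + (j + 1)) / (x + (k + j + 1)) := div_pos (by linarith) h
  have hlt : 1 / (x + (k + j + 1)) * x < (x - y + (j + 1)) / (x + (k + j + 1)) := by
    rw [one_div, inv_mul_eq_div]
    gcongr
    linarith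
  have hfr : (1 - (x - y + (j + 1)) / (x + (k + j + 1))) / (1 / (x + (k + j + 1))) = y + k := by
    field_simp
    ring
  simp only [skewProd, invBranch, fiberMap, hg]
  rw [if_neg (by positivity), if_neg hpos.not_ge, if_neg hlt.not_ge, hfr, Int.fract_add_natCast,
    Int.fract_eq_self.2 ⟨hy0.le, hy1⟩]

lemma skewProd_invBranch_inr (i j : ℕ) {z : ℝ × ℝ} (hz : z ∈ openSquare) :
    skewProd (invBranch (.inr (i, j)) z) = (1 / (z.1 + (j + 1)), -z.2) := by
  obtain ⟨x, y⟩ := z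
  obtain ⟨⟨hx0, hx1⟩, hy0, hy1⟩ := hz
  simp only at hx0 hx1 hy0 hy1
  have h : 0 < x + (j + 1) := by positivity
  have hd : 0 < (i + 1) * (x + (j + 1)) + 1 := by positivity
  have hj : (0 : ℝ) ≤ j := j.cast_nonneg
  have hg : gaussMap ((x + (j + 1)) / ((i + 1) * (x + (j + 1)) + 1)) = 1 / (x + (j + 1)) := by
    have h1 : 1 / (x + (j + 1)) < 1 := by
      rw [div_lt_one h]
      linarith
    convert gaussMap_one_div_add (by positivity) h1 (i + 1) using 2
    push_cast
    field_simp
    ring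
  have hprod : (x + (j + 1)) / ((i + 1) * (x + (j + 1)) + 1) * (1 / (x + (j + 1))) =
      1 / ((i + 1) * (x + (j + 1)) + 1) := by
    field_simp
  simp only [skewProd, invBranch, fiberMap, hg, hprod]
  rw [if_neg (by positivity), if_neg (not_le.2 (by positivity)), if_pos (by gcongr)]
  congr 1
  field_simp

lemma skewProd_lower {x y : ℝ} (hx0 : 0 < x) (hx1 : x < 1) (hy : 0 ≤ y) (n : ℕ) :
    skewProd (1 / (x + n), -y) = (x, y) := by
  have h : 0 < x + n := by positivity
  simp only [skewProd, fiberMap, gaussMap_one_div_add hx0 hx1]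
  rw [if_neg (by positivity), if_pos (by linarith), neg_neg]

lemma skewProd_skewProd_invBranch_inr (i j : ℕ) {z : ℝ × ℝ} (hz : z ∈ openSquare) :
    skewProd (skewProd (invBranch (.inr (i, j)) z)) = z := by
  rw [skewProd_invBranch_inr i j hz]
  simpa using skewProd_lower hz.1.1 hz.1.2 hz.2.1.le (j + 1)

lemma eq_of_invBranch_eq {e e' : (ℕ × ℕ) ⊕ (ℕ × ℕ)} {z z' : ℝ × ℝ} (hz : z ∈ openSquare)
    (hz' : z' ∈ openSquare) (h : invBranch e z = invBranch e' z') : e = e' := by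
  have hlower : ∀ i j {z}, z ∈ openSquare → (skewProd (invBranch (.inr (i, j)) z)).2 < 0 := by
    intro i j z hz
    rw [skewProd_invBranch_inr i j hz]
    exact neg_neg_of_pos hz.2.1
  rcases e with ⟨k, j⟩ | ⟨k, j⟩ <;> rcases e' with ⟨k', j'⟩ | ⟨k', j'⟩
  · have hzz : z = z' := by
      rw [← skewProd_invBranch_inl k j hz, h, skewProd_invBranch_inl k' j' hz']
    subst hzz
    have hx := hz.1.1
    have h1 : z.1 + (k + j + 1) = z.1 + (k' + j' + 1) := by
      simpa [invBranch] using congrArg Prod.fst h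
    have h2 := congrArg Prod.snd h
    simp only [invBranch, h1] at h2
    rw [div_left_inj' (by positivity)] at h2
    have hj : (j : ℝ) = j' := by linarith
    have hk : (k : ℝ) = k' := by linarith
    rw [Nat.cast_inj.1 hj, Nat.cast_inj.1 hk]
  · have := hlower k' j' hz'
    rw [← h, skewProd_invBranch_inl k j hz] at this
    exact absurd hz.2.1 this.not_gt
  · have := hlower k j hz
    rw [h, skewProd_invBranch_inl k' j' hz'] at this
    exact absurd hz'.2.1 this.not_gt
  · have hzz : z = z' := by
      rw [← skewProd_skewProd_invBranch_inr k j hz, h, skewProd_skewProd_invBranch_inr k' j' hz']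
    subst hzz
    have hx := hz.1.1
    have h1 : j = j' := by
      have := congrArg skewProd h
      rw [skewProd_invBranch_inr k j hz, skewProd_invBranch_inr k' j' hz] at this
      simpa using congrArg Prod.fst this
    subst h1
    have h2 := congrArg Prod.snd h
    have hy := hz.2.1
    simp only [invBranch] at h2
    have h3 : 0 < z.1 + (j + 1) := by positivity
    rw [div_eq_div_iff (by positivity) (by positivity), mul_right_inj' hy.ne', add_left_inj,
      mul_left_inj' h3.ne', add_left_inj, Nat.cast_inj] at h2
    rw [h2]

lemma gaussMap_eq_sub (x : ℝ) (hx0 : 0 < x) (hx1 : x < 1) :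
    ∃ n : ℕ, gaussMap x = 1 / x - (n + 1) := by
  have h : 1 ≤ ⌊1 / x⌋₊ := Nat.le_floor (by rw [Nat.cast_one, le_div_iff₀ hx0]; linarith)
  refine ⟨⌊1 / x⌋₊ - 1, ?_⟩
  rw [gaussMap, if_neg hx0.ne', Int.fract, ← natCast_floor_eq_intCast_floor (by positivity)]
  push_cast [h]
  ring

lemma exists_eq_one_div_add {x : ℝ} (hx : Irrational x) (hx0 : 0 < x) (hx1 : x < 1) :
    ∃ n : ℕ, ∃ t ∈ Ioo (0 : ℝ) 1, Irrational t ∧ x = 1 / (t + (n + 1)) := by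
  obtain ⟨n, hn⟩ := gaussMap_eq_sub x hx0 hx1
  have hirr : Irrational (gaussMap x) := by
    rw [hn, one_div]
    exact_mod_cast hx.inv.sub_natCast (n + 1)
  refine ⟨n, gaussMap x, ⟨lt_of_le_of_ne ?_ hirr.ne_zero.symm, ?_⟩, hirr, ?_⟩
  · rw [gaussMap, if_neg hx0.ne']
    exact Int.fract_nonneg _
  · rw [gaussMap, if_neg hx0.ne']
    exact Int.fract_lt_one _
  · rw [hn]
    field_simp
    ring

lemma mem_image_invBranch {z : ℝ × ℝ} (hz : z ∈ openSquare) (hirr : Irrational z.1)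
    (hlin : ∀ k : ℕ, z.2 ≠ 1 - k * z.1) : z ∈ ⋃ e, invBranch e '' openSquare := by
  obtain ⟨ρ, α⟩ := z
  obtain ⟨⟨hρ0, hρ1⟩, hα0, hα1⟩ := hz
  simp only at hirr hlin hρ0 hρ1 hα0 hα1
  obtain ⟨n, x, ⟨hx0, hx1⟩, hx, hρ⟩ := exists_eq_one_div_add hirr hρ0 hρ1
  have hden : 0 < x + (n + 1) := by positivity
  have hn : (0 : ℝ) ≤ n := n.cast_nonneg
  rw [mem_iUnion]
  rcases lt_or_gt_of_ne (hlin (n + 1)) with hlt | hgt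
  · obtain ⟨m, t, ⟨ht0, ht1⟩, -, rfl⟩ := exists_eq_one_div_add hx hx0 hx1
    have hden2 : 0 < t + (m + 1) := by positivity
    have hpos : 0 < (n + 1) * (t + (m + 1)) + 1 := by positivity
    have hlin' : 1 - ((n + 1 : ℕ) : ℝ) * ρ = 1 / ((n + 1) * (t + (m + 1)) + 1) := by
      rw [hρ]
      push_cast
      field_simp
      ring
    rw [hlin', lt_div_iff₀ hpos] at hlt
    refine ⟨.inr (n, m), (t, α * ((n + 1) * (t + (m + 1)) + 1)),
      ⟨⟨ht0, ht1⟩, by positivity, hlt⟩, ?_⟩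
    simp only [invBranch, Prod.mk.injEq]
    refine ⟨?_, mul_div_cancel_right₀ _ hpos.ne'⟩
    rw [hρ]
    field_simp
    ring
  · set s := (1 - α) * (x + (n + 1)) with hs
    have hs0 : 0 ≤ s := mul_nonneg (by linarith) hden.le
    have hne : ∀ k : ℕ, s ≠ k := by
      intro k hk
      apply hlin k
      rw [← hk, hρ, hs]
      field_simp
      ring
    have hfl : ((⌊s⌋₊ : ℕ) : ℝ) < s :=
      lt_of_le_of_ne (Nat.floor_le hs0) (hne _).symm
    have hfl' : s < ⌊s⌋₊ + 1 := Nat.lt_floor_add_one s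
    have hsn : s < n + 1 := by
      have h1 : (1 - α) < (n + 1) * ρ := by
        push_cast at hgt
        linarith
      rw [hρ, mul_one_div, lt_div_iff₀ hden] at h1
      exact h1
    have hk : ⌊s⌋₊ ≤ n := by
      have : ((⌊s⌋₊ : ℕ) : ℝ) < (n + 1 : ℕ) := by
        push_cast
        linarith
      exact Nat.lt_succ_iff.1 (Nat.cast_lt.1 this)
    have hcast : ((n - ⌊s⌋₊ : ℕ) : ℝ) = n - ⌊s⌋₊ := Nat.cast_sub hk
    refine ⟨.inl (⌊s⌋₊, n - ⌊s⌋₊), (x, s - ⌊s⌋₊),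
      ⟨⟨hx0, hx1⟩, by simp only; linarith, by simp only; linarith⟩, ?_⟩
    simp only [invBranch, Prod.mk.injEq, hcast]
    rw [show x + ((⌊s⌋₊ : ℝ) + (n - ⌊s⌋₊) + 1) = x + (n + 1) by ring, ← hρ]
    refine ⟨rfl, ?_⟩
    rw [div_eq_iff hden.ne']
    linarith [hs]

lemma volume_irrational_fst_compl : volume {z : ℝ × ℝ | ¬ Irrational z.1} = 0 := by
  have : {z : ℝ × ℝ | ¬ Irrational z.1} = (range ((↑) : ℚ → ℝ)) ×ˢ univ := by
    ext z
    simp [Irrational]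
  rw [this, Measure.volume_eq_prod, Measure.prod_prod,
    (countable_range _).measure_zero, zero_mul]

lemma volume_line (k : ℝ) : volume {z : ℝ × ℝ | z.2 = 1 - k * z.1} = 0 := by
  have hm : MeasurableSet {z : ℝ × ℝ | z.2 = 1 - k * z.1} :=
    measurableSet_eq_fun (by fun_prop) (by fun_prop)
  rw [Measure.volume_eq_prod, Measure.measure_prod_null hm]
  filter_upwards with x
  simp [preimage]

lemma volume_openSquare_diff_iUnion_invBranch :
    volume (openSquare \ ⋃ e, invBranch e '' openSquare) = 0 := by
  refine measure_mono_null (t := {z : ℝ × ℝ | ¬ Irrational z.1} ∪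
    ⋃ k : ℕ, {z : ℝ × ℝ | z.2 = 1 - k * z.1}) ?_ (measure_union_null
      volume_irrational_fst_compl (measure_iUnion_null fun k => volume_line k))
  rintro z ⟨hz, hmem⟩
  by_contra hcon
  simp only [mem_union, mem_ofPred_eq, mem_iUnion, not_or, not_not, not_exists] at hcon
  exact hmem (mem_image_invBranch hz hcon.1 hcon.2)

/-- The composition of inverse branches along a word; the head of the list is applied first. -/
def wordMap : List ((ℕ × ℕ) ⊕ (ℕ × ℕ)) → ℝ × ℝ → ℝ × ℝ
  | [] => id
  | e :: w => wordMap w ∘ invBranch e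

lemma exists_projBranch_wordMap (w : List ((ℕ × ℕ) ⊕ (ℕ × ℕ))) :
    ∃ f : ProjBranch, (w.length : ℝ) + 1 ≤ f.c + f.d ∧
      EqOn (wordMap w) f.toMap closedSquare := by
  induction w with
  | nil =>
    refine ⟨⟨1, 0, 0, 1, 0, 1, 0, le_rfl, le_rfl, zero_le_one, by simp, by simp⟩, by simp, ?_⟩
    intro z _
    simp [wordMap, ProjBranch.toMap]
  | cons e w ih =>
    obtain ⟨f, hf, hEq⟩ := ih
    obtain ⟨g, hg, hfg⟩ := f.exists_comp_invBranch e
    refine ⟨g, by push_cast [List.length_cons]; linarith, fun z hz => ?_⟩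
    rw [wordMap, Function.comp_apply, hEq (invBranch_mapsTo_closedSquare e hz), hfg z hz.1.1]

lemma wordMap_cons_image_subset (e : (ℕ × ℕ) ⊕ (ℕ × ℕ)) (w : List ((ℕ × ℕ) ⊕ (ℕ × ℕ))) :
    wordMap (e :: w) '' openSquare ⊆ wordMap w '' openSquare := by
  rw [wordMap, image_comp]
  exact image_mono (invBranch_mapsTo_openSquare e).image_subset

lemma wordMap_cons_image_closedSquare_subset (e : (ℕ × ℕ) ⊕ (ℕ × ℕ))
    (w : List ((ℕ × ℕ) ⊕ (ℕ × ℕ))) :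
    wordMap (e :: w) '' closedSquare ⊆ wordMap w '' closedSquare := by
  rw [wordMap, image_comp]
  exact image_mono (invBranch_mapsTo_closedSquare e).image_subset

lemma injOn_wordMap (w : List ((ℕ × ℕ) ⊕ (ℕ × ℕ))) : InjOn (wordMap w) closedSquare := by
  obtain ⟨f, -, hf⟩ := exists_projBranch_wordMap w
  exact f.injOn_closedSquare.congr hf.symm

/-- Distinct words of the same length have disjoint cylinders. -/
lemma eq_of_mem_cylinders {w w' : List ((ℕ × ℕ) ⊕ (ℕ × ℕ))} (hlen : w.length = w'.length)
    {z : ℝ × ℝ} (hz : z ∈ wordMap w '' openSquare) (hz' : z ∈ wordMap w' '' openSquare) :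
    w = w' := by
  induction w generalizing w' with
  | nil => exact (List.length_eq_zero_iff.1 hlen.symm).symm
  | cons e w ih =>
    cases w' with
    | nil => simp at hlen
    | cons e' w' =>
      obtain rfl := ih (by simpa using hlen) (wordMap_cons_image_subset e w hz)
        (wordMap_cons_image_subset e' w' hz')
      obtain ⟨x, hx, rfl⟩ := hz
      obtain ⟨y, hy, hxy⟩ := hz'
      have := injOn_wordMap w
        (openSquare_subset_closedSquare (invBranch_mapsTo_openSquare e' hy))
        (openSquare_subset_closedSquare (invBranch_mapsTo_openSquare e hx)) hxy
      rw [eq_of_invBranch_eq hy hx this]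

/-- Almost every point of the square lies in a cylinder of each given length. -/
lemma volume_openSquare_diff_cylinders (n : ℕ) :
    volume (openSquare \ ⋃ w ∈ {w : List ((ℕ × ℕ) ⊕ (ℕ × ℕ)) | w.length = n},
      wordMap w '' openSquare) = 0 := by
  induction n with
  | zero =>
    convert measure_empty (μ := (volume : Measure (ℝ × ℝ)))
    simp [wordMap]
  | succ n ih =>
    refine measure_mono_null (t := (openSquare \
      ⋃ w ∈ {w : List ((ℕ × ℕ) ⊕ (ℕ × ℕ)) | w.length = n}, wordMap w '' openSquare) ∪
      ⋃ w, wordMap w '' (openSquare \ ⋃ e, invBranch e '' openSquare)) ?_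
      (measure_union_null ih (measure_iUnion_null fun w => ?_))
    · rintro z ⟨hz, hz'⟩
      simp only [mem_union, Set.mem_sdiff, mem_iUnion, mem_ofPred_eq, exists_prop, not_exists,
        not_and] at hz' ⊢
      refine or_iff_not_imp_left.2 fun h => ?_
      have h' : ∃ w : List ((ℕ × ℕ) ⊕ (ℕ × ℕ)), w.length = n ∧ z ∈ wordMap w '' openSquare := by
        by_contra hcon
        exact h ⟨hz, fun w hw hzw => hcon ⟨w, hw, hzw⟩⟩
      obtain ⟨w, hw, x, hx, rfl⟩ := h'
      refine ⟨w, x, ⟨hx, fun hmem => ?_⟩, rfl⟩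
      obtain ⟨e, y, hy, rfl⟩ := mem_iUnion.1 hmem
      exact hz' (e :: w) (by simp [hw]) ⟨y, hy, rfl⟩
    · obtain ⟨f, -, hf⟩ := exists_projBranch_wordMap w
      have hsub : openSquare \ ⋃ e, invBranch e '' openSquare ⊆ closedSquare :=
        sdiff_subset.trans openSquare_subset_closedSquare
      rw [(hf.mono hsub).image_eq]
      exact ProjBranch.volume_image_eq_zero hsub volume_openSquare_diff_iUnion_invBranch

lemma isCompact_image_wordMap (w : List ((ℕ × ℕ) ⊕ (ℕ × ℕ))) :
    IsCompact (wordMap w '' closedSquare) := by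
  obtain ⟨f, -, hf⟩ := exists_projBranch_wordMap w
  rw [hf.image_eq]
  exact (isCompact_Icc.prod isCompact_Icc).image_of_continuousOn
    ProjBranch.continuousOn_closedSquare

/-- Two points that lie in a common cylinder of each length coincide. -/
lemma eq_of_forall_mem_cylinder {w : ℕ → List ((ℕ × ℕ) ⊕ (ℕ × ℕ))}
    (hw : ∀ n, (w n).length = n) {z z' : ℝ × ℝ} (hz : ∀ n, z ∈ wordMap (w n) '' closedSquare)
    (hz' : ∀ n, z' ∈ wordMap (w n) '' closedSquare) : z = z' := by
  choose f hlen hf using fun n => exists_projBranch_wordMap (w n)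
  have hd : ∀ n : ℕ, ((n : ℝ) + 1) / 2 ≤ (f n).d := fun n => by
    have := hlen n
    rw [hw] at this
    linarith [(f n).c_le_d]
  have hlim : Tendsto (fun n : ℕ => 2 * (1 / ((n : ℝ) + 1))) atTop (𝓝 0) := by
    simpa using tendsto_one_div_add_atTop_nhds_zero_nat.const_mul (2 : ℝ)
  have hsmall : ∀ t : ℝ, (∀ n, |t| ≤ 1 / (f n).d) → t = 0 := by
    intro t ht
    refine abs_nonpos_iff.1 (ge_of_tendsto' hlim fun n => (ht n).trans ?_)
    calc 1 / (f n).d ≤ 1 / (((n : ℝ) + 1) / 2) :=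
        one_div_le_one_div_of_le (by positivity) (hd n)
      _ = 2 * (1 / ((n : ℝ) + 1)) := by field_simp
  have hunit : ∀ {s t : ℝ}, s ∈ Icc (0 : ℝ) 1 → t ∈ Icc (0 : ℝ) 1 → |s - t| ≤ 1 :=
    fun hs ht => abs_le.2 ⟨by linarith [hs.1, ht.2], by linarith [hs.2, ht.1]⟩
  choose x hx hxz using hz
  choose y hy hyz using hz'
  have hxz' : ∀ n, (f n).toMap (x n) = z := fun n => by rw [← hf n (hx n), hxz n]
  have hyz' : ∀ n, (f n).toMap (y n) = z' := fun n => by rw [← hf n (hy n), hyz n]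
  have h1 : z.1 = z'.1 := by
    refine sub_eq_zero.1 (hsmall _ fun n => ?_)
    have hd1 := (f n).one_le_d
    rw [← hxz' n, ← hyz' n, (f n).fst_sub_fst (hx n).1.1 (hy n).1.1]
    have ha := (f n).le_denom (hx n).1.1
    have hb := (f n).le_denom (hy n).1.1
    refine div_le_div₀ zero_le_one (hunit (hx n).1 (hy n).1) (by linarith) ?_
    nlinarith
  refine Prod.ext h1 (sub_eq_zero.1 (hsmall _ fun n => ?_))
  have hd1 := (f n).one_le_d
  have hxy : (x n).1 = (y n).1 :=
    (f n).fst_eq_of_map_fst_eq (hx n).1.1 (hy n).1.1 (by rw [hxz' n, hyz' n, h1])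
  rw [← hxz' n, ← hyz' n, (f n).snd_sub_snd (hx n).1.1 hxy]
  exact div_le_div₀ zero_le_one (hunit (hx n).2 (hy n).2) (by linarith)
    ((f n).le_denom (hx n).1.1)

/-- The union of the cylinders of length `n` whose closures lie in `U`. -/
def cylindersIn (U : Set (ℝ × ℝ)) (n : ℕ) : Set (ℝ × ℝ) :=
  ⋃ w ∈ {w : List ((ℕ × ℕ) ⊕ (ℕ × ℕ)) | w.length = n ∧ wordMap w '' closedSquare ⊆ U},
    wordMap w '' openSquare

/-- Almost every point of an open set eventually lies in a cylinder inside the open set. -/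
lemma volume_inter_openSquare_diff_cylindersIn {U : Set (ℝ × ℝ)} (hU : IsOpen U) :
    volume ((U ∩ openSquare) \ ⋃ n, ⋂ m ≥ n, cylindersIn U m) = 0 := by
  refine measure_mono_null ?_ (measure_iUnion_null volume_openSquare_diff_cylinders)
  rintro z ⟨⟨hzU, hz⟩, hz'⟩
  by_contra hcon
  have hex : ∀ n, ∃ w : List ((ℕ × ℕ) ⊕ (ℕ × ℕ)), w.length = n ∧
      z ∈ wordMap w '' openSquare := by
    intro n
    by_contra hn
    refine hcon (mem_iUnion.2 ⟨n, hz, fun hmem => hn ?_⟩)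
    simpa only [mem_iUnion, mem_ofPred_eq, exists_prop] using hmem
  choose w hw hzw using hex
  have hstep : ∀ n, wordMap (w (n + 1)) '' closedSquare ⊆ wordMap (w n) '' closedSquare := by
    intro n
    cases hn : w (n + 1) with
    | nil => simpa [hn] using hw (n + 1)
    | cons e v =>
      have hv : v = w n := by
        refine eq_of_mem_cylinders ?_ (wordMap_cons_image_subset e v (hn ▸ hzw (n + 1))) (hzw n)
        have := hw (n + 1)
        rw [hn, List.length_cons] at this
        rw [hw n]
        omega
      rw [← hv]
      exact wordMap_cons_image_closedSquare_subset e v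
  have hanti : Antitone fun n => wordMap (w n) '' closedSquare := antitone_nat_of_succ_le hstep
  have hzc : ∀ n, z ∈ wordMap (w n) '' closedSquare :=
    fun n => image_mono openSquare_subset_closedSquare (hzw n)
  obtain ⟨n, hn⟩ := exists_subset_nhds_of_isCompact (U := U) hanti.directed_ge
    (fun n => isCompact_image_wordMap (w n)) (fun y hy => by
      rw [eq_of_forall_mem_cylinder hw (mem_iInter.1 hy) hzc]
      exact hU.mem_nhds hzU)
  refine hz' (mem_iUnion.2 ⟨n, mem_iInter₂.2 fun m hm => ?_⟩)
  exact mem_biUnion (show w m ∈ {w : List ((ℕ × ℕ) ⊕ (ℕ × ℕ)) | w.length = m ∧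
    wordMap w '' closedSquare ⊆ U} from ⟨hw m, (hanti hm).trans hn⟩) (hzw m)

/-- A measurable subset of the square that is invariant under all inverse branches occupies a
definite proportion of every open set. -/
lemma volume_mul_volume_inter_openSquare_le {B U : Set (ℝ × ℝ)} (hB : MeasurableSet B)
    (hsub : B ⊆ openSquare) (hinv : ∀ e, ∀ z ∈ B, invBranch e z ∈ B) (hU : IsOpen U) :
    volume B * volume (U ∩ openSquare) ≤ 8 * volume (U ∩ B) := by
  have hword : ∀ w, wordMap w '' B ⊆ B := by
    intro w
    induction w with
    | nil => simp [wordMap]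
    | cons e w ih =>
      rw [wordMap, image_comp]
      exact (image_mono (image_subset_iff.2 (hinv e))).trans ih
  have hcyl : ∀ n, volume B * volume (cylindersIn U n) ≤ 8 * volume (U ∩ B) := by
    intro n
    set W := {w : List ((ℕ × ℕ) ⊕ (ℕ × ℕ)) | w.length = n ∧ wordMap w '' closedSquare ⊆ U}
    have hdisj : W.PairwiseDisjoint fun w => wordMap w '' B := by
      intro w hw w' hw' hne
      refine disjoint_left.2 fun z hz hz' => hne ?_
      exact eq_of_mem_cylinders (hw.1.trans hw'.1.symm) (image_mono hsub hz)
        (image_mono hsub hz')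
    have hmeas : ∀ w ∈ W, MeasurableSet (wordMap w '' B) := by
      intro w _
      obtain ⟨f, -, hf⟩ := exists_projBranch_wordMap w
      have hsub' := hsub.trans openSquare_subset_closedSquare
      rw [(hf.mono hsub').image_eq]
      exact ProjBranch.measurableSet_image hB hsub'
    calc volume B * volume (cylindersIn U n)
        ≤ volume B * ∑' w : W, volume (wordMap w '' openSquare) := by
          gcongr
          exact measure_biUnion_le volume (to_countable W) _
      _ = ∑' w : W, volume B * volume (wordMap w '' openSquare) := ENNReal.tsum_mul_left.symm
      _ ≤ ∑' w : W, 8 * volume (wordMap w '' B) := by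
          refine ENNReal.tsum_le_tsum fun w => ?_
          obtain ⟨f, -, hf⟩ := exists_projBranch_wordMap w
          rw [(hf.mono openSquare_subset_closedSquare).image_eq,
            (hf.mono (hsub.trans openSquare_subset_closedSquare)).image_eq]
          exact ProjBranch.volume_mul_volume_image_openSquare_le hB hsub
      _ = 8 * volume (⋃ w ∈ W, wordMap w '' B) := by
          rw [ENNReal.tsum_mul_left, measure_biUnion (to_countable W) hdisj hmeas]
      _ ≤ 8 * volume (U ∩ B) := by
          gcongr
          refine iUnion₂_subset fun w hw => subset_inter ?_ (hword w)
          exact (image_mono (hsub.trans openSquare_subset_closedSquare)).trans hw.2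
  have hmono : Monotone fun n => ⋂ m ≥ n, cylindersIn U m :=
    fun n n' hn => biInter_mono (fun m hm => hn.trans hm) fun _ _ => Subset.rfl
  calc volume B * volume (U ∩ openSquare)
      ≤ volume B * volume (⋃ n, ⋂ m ≥ n, cylindersIn U m) :=
        mul_le_mul' le_rfl
          (measure_mono_ae (ae_le_set.2 (volume_inter_openSquare_diff_cylindersIn hU)))
    _ = ⨆ n, volume B * volume (⋂ m ≥ n, cylindersIn U m) := by
        rw [hmono.measure_iUnion, ENNReal.mul_iSup]
    _ ≤ 8 * volume (U ∩ B) := by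
        refine iSup_le fun n => le_trans ?_ (hcyl n)
        gcongr
        exact biInter_subset_of_mem (le_refl n)

/-- A measurable subset of the square of positive measure that is invariant under all inverse
branches has full measure in the square. -/
lemma volume_openSquare_diff_eq_zero {B : Set (ℝ × ℝ)} (hB : MeasurableSet B)
    (hsub : B ⊆ openSquare) (hinv : ∀ e, ∀ z ∈ B, invBranch e z ∈ B) (hpos : volume B ≠ 0) :
    volume (openSquare \ B) = 0 := by
  have hfin : volume (openSquare \ B) ≠ ⊤ :=
    measure_ne_top_of_subset sdiff_subset (by simp [volume_openSquare])
  have hle : volume B * volume (openSquare \ B) ≤ 0 := by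
    refine ENNReal.le_of_forall_pos_le_add fun ε hε _ => ?_
    obtain ⟨U, hUsup, hUo, hU⟩ := Set.exists_isOpen_le_add (openSquare \ B) volume
      (ε := ε / 8) (by simpa using hε.ne')
    have hsmall : volume (U ∩ B) ≤ ε / 8 := by
      refine ENNReal.le_of_add_le_add_left hfin (le_trans ?_ hU)
      rw [add_comm, ← measure_inter_add_sdiff U hB]
      exact add_le_add le_rfl (measure_mono fun z hz => ⟨hUsup hz, hz.2⟩)
    calc volume B * volume (openSquare \ B) ≤ volume B * volume (U ∩ openSquare) := by
          gcongr
          exact subset_inter hUsup sdiff_subset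
      _ ≤ 8 * volume (U ∩ B) := volume_mul_volume_inter_openSquare_le hB hsub hinv hUo
      _ ≤ 8 * (ε / 8) := by gcongr
      _ = 0 + ε := by rw [zero_add, ENNReal.mul_div_cancel (by simp) (by simp)]
  exact (mul_eq_zero.1 (nonpos_iff_eq_zero.1 hle)).resolve_left hpos

/-- If `B` is null in the upper square, then almost no point of the lower square is mapped to `B`
by the skew product. -/
lemma volume_lower_eq_zero {B : Set (ℝ × ℝ)} (hB : volume (openSquare ∩ B) = 0) :
    volume {z : ℝ × ℝ | z ∈ Ioo (0 : ℝ) 1 ×ˢ Ioo (-1 : ℝ) 0 ∧ skewProd z ∈ B} = 0 := by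
  refine measure_mono_null (t := {z : ℝ × ℝ | ¬ Irrational z.1} ∪ ⋃ n : ℕ,
    (fun z : ℝ × ℝ => (1 / (z.1 + (n + 1)), -z.2)) '' (openSquare ∩ B)) ?_
    (measure_union_null volume_irrational_fst_compl (measure_iUnion_null fun n => ?_))
  · rintro ⟨ρ, α⟩ ⟨⟨⟨hρ0, hρ1⟩, hα0, hα1⟩, hmem⟩
    simp only at hρ0 hρ1 hα0 hα1
    refine or_iff_not_imp_left.2 fun hirr => ?_
    obtain ⟨n, x, hx, -, rfl⟩ := exists_eq_one_div_add (not_not.1 hirr) hρ0 hρ1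
    have hT : skewProd (1 / (x + (n + 1)), α) = (x, -α) := by
      simpa using skewProd_lower hx.1 hx.2 (neg_nonneg.2 hα1.le) (n + 1)
    refine mem_iUnion.2 ⟨n, (x, -α), ⟨⟨hx, ?_, ?_⟩, hT ▸ hmem⟩, by simp⟩ <;> simp only <;> linarith
  · refine addHaar_image_eq_zero_of_differentiableOn_of_addHaar_eq_zero volume ?_ hB
    rintro z ⟨hz, -⟩
    have hx := hz.1.1
    have : z.1 + ((n : ℝ) + 1) ≠ 0 := by positivity
    exact DifferentiableAt.differentiableWithinAt (by fun_prop (disch := assumption))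

/-- The rectangle is, up to a null set, the union of its open upper and lower squares. -/
lemma volume_Rect_diff :
    volume (Rect \ (openSquare ∪ Ioo (0 : ℝ) 1 ×ˢ Ioo (-1 : ℝ) 0)) = 0 := by
  refine measure_mono_null (t := ({0, 1} ×ˢ univ) ∪ (univ ×ˢ {-1, 0, 1})) ?_ ?_
  · rintro ⟨x, y⟩ ⟨⟨hx, hy⟩, hz⟩
    simp only [openSquare, mem_union, mem_prod, mem_Ioo, mem_Icc, mem_insert_iff,
      mem_singleton_iff, mem_univ, and_true, true_and] at hx hy hz ⊢
    grind
  · rw [Measure.volume_eq_prod]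
    refine measure_union_null ?_ ?_ <;> rw [Measure.prod_prod]
    · rw [(toFinite ({0, 1} : Set ℝ)).measure_zero, zero_mul]
    · rw [(toFinite ({-1, 0, 1} : Set ℝ)).measure_zero, mul_zero]

/-- **Corollary A.10.** If `A ⊆ R` is a Borel set, strongly invariant under `T` (as a self-map
of `R`), and of positive Lebesgue measure, then `R ∖ A` has Lebesgue measure zero. -/
theorem invariantFullMeasure (A : Set (ℝ × ℝ)) (hA : A ⊆ Rect) (hAm : MeasurableSet A)
    (hinv : Rect ∩ skewProd ⁻¹' A = A) (hpos : 0 < volume A) :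
    volume (Rect \ A) = 0 := by
  have hstep : ∀ {z}, z ∈ Rect → skewProd z ∈ A → z ∈ A :=
    fun hz h => hinv.subset ⟨hz, h⟩
  have hstep' : ∀ {z}, z ∈ A → skewProd z ∈ A := fun h => (hinv.superset h).2
  have hsquare : openSquare ⊆ Rect :=
    prod_mono Ioo_subset_Icc_self fun y hy => ⟨by linarith [hy.1], hy.2.le⟩
  have hlow : Ioo (0 : ℝ) 1 ×ˢ Ioo (-1 : ℝ) 0 ⊆ Rect :=
    prod_mono Ioo_subset_Icc_self fun y hy => ⟨hy.1.le, by linarith [hy.2]⟩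
  have hbranch : ∀ e, ∀ z ∈ openSquare ∩ A, invBranch e z ∈ openSquare ∩ A := by
    rintro e z ⟨hz, hzA⟩
    have hmem := invBranch_mapsTo_openSquare e hz
    refine ⟨hmem, hstep (hsquare hmem) ?_⟩
    rcases e with ⟨k, j⟩ | ⟨i, j⟩
    · rwa [skewProd_invBranch_inl k j hz]
    · refine hstep ?_ (by rwa [skewProd_skewProd_invBranch_inr i j hz])
      rw [skewProd_invBranch_inr i j hz]
      have hx := hz.1.1
      have hj : (0 : ℝ) ≤ j := j.cast_nonneg
      refine ⟨⟨by simp only; positivity, ?_⟩, ?_, ?_⟩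
      · simp only
        rw [div_le_one (by positivity)]
        linarith
      · simp only
        linarith [hz.2.2]
      · simp only
        linarith [hz.2.1]
  have hupper : volume (openSquare ∩ A) ≠ 0 := by
    intro h0
    refine hpos.ne' (measure_mono_null ?_ (measure_union_null volume_Rect_diff
      (measure_union_null h0 (volume_lower_eq_zero h0))))
    intro z hz
    by_cases hz' : z ∈ openSquare ∪ Ioo (0 : ℝ) 1 ×ˢ Ioo (-1 : ℝ) 0
    · rcases hz' with hz' | hz'
      · exact .inr (.inl ⟨hz', hz⟩)
      · exact .inr (.inr ⟨hz', hstep' hz⟩)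
    · exact .inl ⟨hA hz, hz'⟩
  have hfull : volume (openSquare ∩ Aᶜ) = 0 := by
    rw [← volume_openSquare_diff_eq_zero (measurableSet_openSquare.inter hAm) inter_subset_left
      hbranch hupper, sdiff_self_inter, sdiff_eq]
  refine measure_mono_null ?_ (measure_union_null volume_Rect_diff
    (measure_union_null hfull (volume_lower_eq_zero hfull)))
  rintro z ⟨hz, hzA⟩
  by_cases hz' : z ∈ openSquare ∪ Ioo (0 : ℝ) 1 ×ˢ Ioo (-1 : ℝ) 0
  · rcases hz' with hz' | hz'
    · exact .inr (.inl ⟨hz', hzA⟩)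
    · exact .inr (.inr ⟨hz', fun h => hzA (hstep (hlow hz') h)⟩)
  · exact .inl ⟨hz, hz'⟩
end
end

section
/- If ρ₀∈(0,1/8) is irrational, then for every α∈[2ρ₀,3ρ₀] the pair (ρ₀,α) is admissible. -/
noncomputable section

open Set Filter MeasureTheory Topology

/-- The circle `ℝ/ℤ`. -/
abbrev S1 := AddCircle (1 : ℝ)

/-- `F` is an (orientation-preserving) lift of the circle map `f`. -/
def IsLift (f : S1 → S1) (F : ℝ → ℝ) : Prop :=
  StrictMono F ∧ Function.Surjective F ∧ (∀ x : ℝ, F (x + 1) = F x + 1) ∧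
    ∀ x : ℝ, f (x : S1) = (F x : S1)

/-- `f` is an orientation-preserving circle homeomorphism. -/
def IsCircleHomeo (f : S1 → S1) : Prop := ∃ F : ℝ → ℝ, IsLift f F

/-- `f` has rotation number `ρ ∈ [0,1)`: some lift of `f` has translation number `ρ`. -/
def HasRotNum (f : S1 → S1) (ρ : ℝ) : Prop :=
  ∃ F : ℝ → ℝ, IsLift f F ∧ Tendsto (fun n : ℕ => F^[n] 0 / (n : ℝ)) atTop (𝓝 ρ)

/-- The lift `F` has a non-flat (power-law) critical point at `c`:
on a neighbourhood `W` of `c`, `F y = F c + φ(y)|φ(y)|^(d-1)` for a `C³` diffeomorphism `φ`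
with `φ c = 0`. -/
def NonFlatAt (F : ℝ → ℝ) (c : ℝ) : Prop :=
  ∃ d : ℝ, 1 < d ∧ ∃ W : Set ℝ, IsOpen W ∧ c ∈ W ∧ ∃ φ : ℝ → ℝ,
    ContDiffOn ℝ 3 φ W ∧ InjOn φ W ∧ (∀ y ∈ W, deriv φ y ≠ 0) ∧ φ c = 0 ∧
    ∀ y ∈ W, F y = F c + φ y * |φ y| ^ (d - 1)

/-- `f` is a `C^k` unicritical circle map: an orientation-preserving `C^k` circle
homeomorphism whose only critical point is `c`, and it is non-flat. -/
def Unicritical (f : S1 → S1) (c : S1) (k : ℕ∞) : Prop :=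
  ∃ (F : ℝ → ℝ) (x₀ : ℝ), IsLift f F ∧ ContDiff ℝ k F ∧ (x₀ : S1) = c ∧
    {x : ℝ | deriv F x = 0} = {x : ℝ | ∃ m : ℤ, x = x₀ + m} ∧ NonFlatAt F x₀

/-- `f` is a `C^k` bi-critical circle map: an orientation-preserving `C^k` circle
homeomorphism with exactly two critical points `c₁ ≠ c₂`, both non-flat. -/
def Bicritical (f : S1 → S1) (c₁ c₂ : S1) (k : ℕ∞) : Prop :=
  c₁ ≠ c₂ ∧ ∃ (F : ℝ → ℝ) (x₁ x₂ : ℝ), IsLift f F ∧ ContDiff ℝ k F ∧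
    (x₁ : S1) = c₁ ∧ (x₂ : S1) = c₂ ∧
    {x : ℝ | deriv F x = 0} =
      {x : ℝ | ∃ m : ℤ, x = x₁ + m} ∪ {x : ℝ | ∃ m : ℤ, x = x₂ + m} ∧
    NonFlatAt F x₁ ∧ NonFlatAt F x₂

/-- `h` is a quasisymmetric (orientation-preserving) circle homeomorphism. -/
def QuasiSymm (h : S1 → S1) : Prop :=
  ∃ H : ℝ → ℝ, IsLift h H ∧ ∃ M : ℝ, 1 < M ∧ ∀ x t : ℝ, 0 < t →
    1 / M ≤ (H (x + t) - H x) / (H x - H (x - t)) ∧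
      (H (x + t) - H x) / (H x - H (x - t)) ≤ M

/-- The length (in `[0,1)`) of the positively oriented arc from `x` to `y`. -/
def arcLen (x y : S1) : ℝ := (AddCircle.equivIco 1 0 (y - x) : ℝ)

/-- The positively oriented open arc from `x` to `y` on the circle. -/
def posArc (x y : S1) : Set S1 := (fun t : ℝ => x + (t : S1)) '' Ioo 0 (arcLen x y)

/-- A pair `(ρ,α)` is admissible if there is a `C^∞` bi-critical circle map `g` with rotation
number `ρ`, unique invariant measure `μ`, and critical points `c₁, c₂` such that the two
connected components of `S¹ ∖ {c₁,c₂}` have `μ`-measures `α` and `1-α` respectively. -/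
def Admissible (ρ α : ℝ) : Prop :=
  ∃ (g : S1 → S1) (c₁ c₂ : S1) (μ : Measure S1),
    Bicritical g c₁ c₂ ⊤ ∧ HasRotNum g ρ ∧
    IsProbabilityMeasure μ ∧ μ.map g = μ ∧
    (μ (posArc c₁ c₂)).toReal = α ∧ (μ (posArc c₂ c₁)).toReal = 1 - α

/-! ### Irrational rotations -/

lemma Irrational.exists_nat_mul_add_int_mem_Ioo {ρ : ℝ} (hρ : Irrational ρ) {a b : ℝ}
    (hab : a < b) : ∃ (m : ℕ) (n : ℤ), (m : ℝ) * ρ + n ∈ Ioo a b := by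
  have hd : DenseRange (fun m : ℕ => m • (ρ : S1)) := by
    rw [← denseRange_zsmul_iff_nsmul, AddCircle.denseRange_zsmul_coe_iff]
    simpa using hρ
  have ho : IsOpen ((fun t : ℝ => (t : S1)) '' Ioo a b) :=
    QuotientAddGroup.isOpenMap_coe _ isOpen_Ioo
  obtain ⟨m, y, hy, hm⟩ := hd.exists_mem_open ho ((nonempty_Ioo.2 hab).image _)
  have hm' : ((y - m • ρ : ℝ) : S1) = 0 := by
    rw [AddCircle.coe_sub, AddCircle.coe_nsmul, sub_eq_zero]
    exact hm
  obtain ⟨n, hn⟩ := AddCircle.coe_eq_zero_iff (1 : ℝ) |>.1 hm'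
  refine ⟨m, n, ?_⟩
  have : (m : ℝ) * ρ + n = y := by
    simp only [zsmul_eq_mul, mul_one, nsmul_eq_mul] at hn
    linarith
  rwa [this]

namespace CircleDeg1Lift

variable {f g h k : CircleDeg1Lift} {ρ : ℝ}

lemma semiconj_iterate_apply (hh : ∀ y, h (f y) = h y + ρ) (m : ℕ) (y : ℝ) :
    h (f^[m] y) = h y + m * ρ := by
  induction m with
  | zero => simp
  | succ m ih =>
    rw [Function.iterate_succ_apply', hh, ih]
    push_cast
    ring

lemma apply_add_nat_mul (hk : ∀ s, k (s + ρ) = f (k s)) (m : ℕ) (s : ℝ) :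
    k (s + m * ρ) = f^[m] (k s) := by
  induction m with
  | zero => simp
  | succ m ih =>
    rw [Function.iterate_succ_apply', ← ih, ← hk]
    congr 1
    push_cast
    ring

/-- A degree one monotone map commuting with an irrational translation is a translation. -/
lemma eq_add_of_commute_add_irrational (hρ : Irrational ρ) (hh : ∀ y, h (y + ρ) = h y + ρ)
    (y : ℝ) : h y = y + h 0 := by
  have key : ∀ (m : ℕ) (n : ℤ), h ((m : ℝ) * ρ + n) = m * ρ + n + h 0 := by
    intro m n
    have := apply_add_nat_mul (f := translate (Multiplicative.ofAdd ρ)) (k := h) (ρ := ρ)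
      (fun s => by rw [hh, translate_apply, add_comm]) m 0
    rw [h.map_add_int, ← zero_add ((m : ℝ) * ρ), this, translate_iterate, translate_apply]
    ring
  refine le_antisymm (le_of_forall_pos_lt_add fun ε hε => ?_)
    (le_of_forall_pos_lt_add fun ε hε => ?_)
  · obtain ⟨m, n, h1, h2⟩ := hρ.exists_nat_mul_add_int_mem_Ioo (lt_add_of_pos_right y hε)
    have := h.monotone h1.le
    rw [key] at this
    linarith
  · obtain ⟨m, n, h1, h2⟩ := hρ.exists_nat_mul_add_int_mem_Ioo (sub_lt_self y hε)
    have := h.monotone h2.le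
    rw [key] at this
    linarith

/-- A degree one homeomorphism with irrational translation number is semiconjugate to the
translation, and the semiconjugacy has a monotone section. -/
lemma exists_semiconj_section (hf : Function.Bijective f) (hρ : Irrational ρ)
    (hτ : translationNumber f = ρ) :
    ∃ h k : CircleDeg1Lift, h 0 = 0 ∧ (∀ y, h (f y) = h y + ρ) ∧
      (∀ s, k (s + ρ) = f (k s)) ∧ ∀ s, h (k s) = s := by
  have hT : IsUnit (translate (Multiplicative.ofAdd ρ) : CircleDeg1Lift) := Units.isUnit _
  have hU : IsUnit f := isUnit_iff_bijective.2 hf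
  obtain ⟨h₀, hh₀⟩ := semiconj_of_isUnit_of_translationNumber_eq hU hT
    (by rw [hτ, translationNumber_translate])
  obtain ⟨k₀, hk₀⟩ := semiconj_of_isUnit_of_translationNumber_eq hT hU
    (by rw [hτ, translationNumber_translate])
  have hh₁ : ∀ y, h₀ (f y) = h₀ y + ρ := fun y => by
    rw [hh₀ y, translate_apply, add_comm]
  have hk₁ : ∀ s, k₀ (s + ρ) = f (k₀ s) := fun s => by
    rw [← hk₀ s, translate_apply, add_comm]
  have hc : ∀ s, h₀ (k₀ s) = s + h₀ (k₀ 0) :=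
    eq_add_of_commute_add_irrational (h := h₀ * k₀) hρ fun s => by
      simp only [mul_apply, hk₁, hh₁]
  refine ⟨translate (Multiplicative.ofAdd (-h₀ 0)) * h₀,
    k₀ * translate (Multiplicative.ofAdd (h₀ 0 - h₀ (k₀ 0))), ?_, ?_, ?_, ?_⟩
  · simp
  · intro y
    simp only [mul_apply, translate_apply, hh₁]
    ring
  · intro s
    simp only [mul_apply, translate_apply, ← hk₁]
    congr 1
    ring
  · intro s
    simp only [mul_apply, translate_apply]
    rw [hc]
    ring

/-- The translation number increases strictly at irrational values. -/
lemma translationNumber_ne_of_add_le (hf : Function.Bijective f) (hρ : Irrational ρ)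
    (hτ : translationNumber f = ρ) {δ : ℝ} (hδ : 0 < δ) (hfg : ∀ y, f y + δ ≤ g y) :
    translationNumber g ≠ ρ := by
  obtain ⟨h, k, -, -, hk, -⟩ := exists_semiconj_section hf hρ hτ
  obtain ⟨s, hs⟩ : ∃ s, ContinuousAt k s := by
    by_contra! hcon
    have := k.monotone.countable_not_continuousAt
    rw [show {x | ¬ContinuousAt k x} = univ from eq_univ_of_forall hcon] at this
    exact not_countable_univ this
  obtain ⟨ε, hε, hball⟩ := Metric.continuousAt_iff.1 hs δ hδ
  have hε' : 0 < min ε 1 := lt_min hε one_pos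
  obtain ⟨m, n, h1, h2⟩ := hρ.exists_nat_mul_add_int_mem_Ioo (neg_lt_zero.2 hε')
  have hm : m ≠ 0 := by
    rintro rfl
    simp only [Nat.cast_zero, zero_mul, zero_add] at h1 h2
    have h3 : (-1 : ℝ) < n := lt_of_le_of_lt (neg_le_neg (min_le_right _ _)) h1
    have h4 : (-1 : ℤ) < n := by exact_mod_cast h3
    have h5 : n < (0 : ℤ) := by exact_mod_cast h2
    omega
  have hle : (g ^ m) (k s) + n ≥ k s := by
    obtain ⟨l, rfl⟩ := Nat.exists_eq_succ_of_ne_zero hm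
    have hle' : f ≤ g := fun y => by linarith [hfg y]
    have h3 : f^[l + 1] (k s) + δ ≤ g^[l + 1] (k s) := by
      rw [Function.iterate_succ_apply', Function.iterate_succ_apply']
      exact (add_le_add_left (f.monotone (iterate_mono hle' l (k s))) δ).trans (hfg _)
    have h4 : k (s + ((l + 1 : ℕ) * ρ + n)) = f^[l + 1] (k s) + n := by
      rw [← add_assoc, k.map_add_int, apply_add_nat_mul hk]
    have h5 : dist (k (s + ((l + 1 : ℕ) * ρ + n))) (k s) < δ := by
      apply hball
      rw [Real.dist_eq, add_sub_cancel_left, abs_lt]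
      exact ⟨lt_of_le_of_lt (neg_le_neg (min_le_left _ _)) h1, h2.trans hε⟩
    rw [Real.dist_eq, abs_lt, h4] at h5
    rw [coe_pow]
    linarith [h5.1]
  have h6 : ((-n : ℤ) : ℝ) ≤ translationNumber (g ^ m) := by
    refine le_translationNumber_of_add_int_le (x := k s) _ ?_
    push_cast
    linarith
  intro hg
  rw [translationNumber_pow, hg] at h6
  push_cast at h6
  linarith

lemma translationNumber_le_iff_forall_iterate_le {f : CircleDeg1Lift} {z : ℝ} :
    translationNumber f ≤ z ↔ ∀ m : ℕ, f^[m] 0 ≤ m * z + 1 := by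
  constructor
  · intro hz m
    have := dist_pow_map_zero_mul_translationNumber_le f m
    rw [Real.dist_eq, abs_le, coe_pow] at this
    have h2 := mul_le_mul_of_nonneg_left hz (Nat.cast_nonneg (α := ℝ) m)
    linarith [this.2]
  · intro hm
    refine le_of_tendsto_of_tendsto f.tendsto_translation_number₀
      (g := fun m : ℕ => z + 1 / (m : ℝ)) ?_ ?_
    · simpa using tendsto_const_nhds.add (tendsto_one_div_atTop_nhds_zero_nat (𝕜 := ℝ))
    · filter_upwards [eventually_gt_atTop 0] with m hm0
      have : (0 : ℝ) < m := by exact_mod_cast hm0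
      rw [div_le_iff₀ this, coe_pow]
      have := hm m
      field_simp
      linarith

lemma le_translationNumber_iff_forall_le_iterate {f : CircleDeg1Lift} {z : ℝ} :
    z ≤ translationNumber f ↔ ∀ m : ℕ, m * z - 1 ≤ f^[m] 0 := by
  constructor
  · intro hz m
    have := dist_pow_map_zero_mul_translationNumber_le f m
    rw [Real.dist_eq, abs_le, coe_pow] at this
    have h2 := mul_le_mul_of_nonneg_left hz (Nat.cast_nonneg (α := ℝ) m)
    linarith [this.1]
  · intro hm
    refine le_of_tendsto_of_tendsto (f := fun m : ℕ => z - 1 / (m : ℝ)) ?_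
      f.tendsto_translation_number₀ ?_
    · simpa using tendsto_const_nhds.sub (tendsto_one_div_atTop_nhds_zero_nat (𝕜 := ℝ))
    · filter_upwards [eventually_gt_atTop 0] with m hm0
      have : (0 : ℝ) < m := by exact_mod_cast hm0
      rw [le_div_iff₀ this, coe_pow]
      have := hm m
      field_simp
      linarith

lemma continuous_iterate_zero {X : Type*} [TopologicalSpace X] {F : X → CircleDeg1Lift}
    (hF : Continuous fun p : X × ℝ => F p.1 p.2) (m : ℕ) :
    Continuous fun p => (F p)^[m] 0 := by
  induction m with
  | zero => simpa using continuous_const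
  | succ m ih =>
    simp only [Function.iterate_succ_apply']
    exact hF.comp (continuous_id.prodMk ih)

/-- The translation number depends continuously on the map. -/
lemma continuous_translationNumber {X : Type*} [TopologicalSpace X] {F : X → CircleDeg1Lift}
    (hF : Continuous fun p : X × ℝ => F p.1 p.2) :
    Continuous fun p => translationNumber (F p) := by
  rw [continuous_iff_lower_upperSemicontinuous, lowerSemicontinuous_iff_isClosed_preimage,
    upperSemicontinuous_iff_isClosed_preimage]
  constructor
  · intro z
    simp only [preimage, mem_Iic, translationNumber_le_iff_forall_iterate_le, ofPred_forall]
    exact isClosed_iInter fun m => isClosed_le (continuous_iterate_zero hF m) continuous_const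
  · intro z
    simp only [preimage, mem_Ici, le_translationNumber_iff_forall_le_iterate, ofPred_forall]
    exact isClosed_iInter fun m => isClosed_le continuous_const (continuous_iterate_zero hF m)

end CircleDeg1Lift

/-! ### An analytic family with two critical points -/

/-- The derivative in `y` is `(cos (π x) - cos (2 π y - π x)) ^ 2 / (cos (π x) ^ 2 + 1 / 2)`, which
vanishes exactly for `y ∈ ℤ ∪ (x + ℤ)`. -/
def bicriticalFun (x t y : ℝ) : ℝ :=
  y + t + ((Real.sin (2 * (2 * Real.pi * y - Real.pi * x)) + Real.sin (2 * (Real.pi * x))) / 8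
    - Real.cos (Real.pi * x) * (Real.sin (2 * Real.pi * y - Real.pi * x) + Real.sin (Real.pi * x)))
      / (Real.pi * (Real.cos (Real.pi * x) ^ 2 + 1 / 2))

lemma bicriticalFun_zero (x t : ℝ) : bicriticalFun x t 0 = t := by
  have h1 : 2 * Real.pi * 0 - Real.pi * x = -(Real.pi * x) := by ring
  have h2 : 2 * -(Real.pi * x) = -(2 * (Real.pi * x)) := by ring
  simp only [bicriticalFun, h1, h2, Real.sin_neg]
  ring

lemma bicriticalFun_add_one (x t y : ℝ) :
    bicriticalFun x t (y + 1) = bicriticalFun x t y + 1 := by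
  have h1 : 2 * Real.pi * (y + 1) - Real.pi * x = 2 * Real.pi * y - Real.pi * x + 2 * Real.pi := by ring
  have h2 : 2 * (2 * Real.pi * y - Real.pi * x + 2 * Real.pi) =
      2 * (2 * Real.pi * y - Real.pi * x)
      + 2 * Real.pi + 2 * Real.pi := by ring
  simp only [bicriticalFun, h1, h2, Real.sin_add_two_pi]
  ring

lemma hasDerivAt_bicriticalFun (x t y : ℝ) :
    HasDerivAt (bicriticalFun x t)
      ((Real.cos (Real.pi * x) - Real.cos (2 * Real.pi * y - Real.pi * x)) ^ 2 / (Real.cos (Real.pi * x) ^ 2 + 1 / 2)) y := by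
  have hθ : HasDerivAt (fun y : ℝ => 2 * Real.pi * y - Real.pi * x) (2 * Real.pi) y := by
    simpa using ((hasDerivAt_id y).const_mul (2 * Real.pi)).sub_const (Real.pi * x)
  have h1 := (((hθ.const_mul 2).sin.add_const (Real.sin (2 * (Real.pi * x)))).div_const 8).sub
    ((hθ.sin.add_const (Real.sin (Real.pi * x))).const_mul (Real.cos (Real.pi * x)))
  have h2 := ((hasDerivAt_id y).add_const t).add
    (h1.div_const (Real.pi * (Real.cos (Real.pi * x) ^ 2 + 1 / 2)))
  refine h2.congr_deriv ?_
  have hc : Real.cos (Real.pi * x) ^ 2 + 1 / 2 ≠ 0 := by positivity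
  rw [Real.cos_two_mul]
  have := Real.pi_ne_zero
  field_simp
  ring

lemma deriv_bicriticalFun_eq_zero_iff (x t y : ℝ) :
    deriv (bicriticalFun x t) y = 0 ↔ (∃ m : ℤ, y = 0 + m) ∨ ∃ m : ℤ, y = x + m := by
  have hc : Real.cos (Real.pi * x) ^ 2 + 1 / 2 ≠ 0 := by positivity
  have hReal.pi := Real.pi_ne_zero
  rw [(hasDerivAt_bicriticalFun x t y).deriv, div_eq_zero_iff, or_iff_left hc, sq_eq_zero_iff,
    sub_eq_zero, Real.cos_eq_cos_iff]
  constructor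
  · rintro ⟨m, hm | hm⟩
    · right
      refine ⟨m, mul_left_cancel₀ hReal.pi ?_⟩
      linarith
    · left
      refine ⟨m, mul_left_cancel₀ hReal.pi ?_⟩
      linarith
  · rintro (⟨m, hm⟩ | ⟨m, hm⟩)
    · exact ⟨m, Or.inr (by rw [hm]; ring)⟩
    · exact ⟨m, Or.inl (by rw [hm]; ring)⟩

lemma analyticAt_bicriticalFun (x t y : ℝ) : AnalyticAt ℝ (bicriticalFun x t) y := by
  unfold bicriticalFun
  fun_prop

lemma continuous_bicriticalFun :
    Continuous fun p : (ℝ × ℝ) × ℝ => bicriticalFun p.1.1 p.1.2 p.2 := by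
  unfold bicriticalFun
  refine Continuous.add (by fun_prop) (Continuous.div (by fun_prop) (by fun_prop) fun p => ?_)
  have := Real.pi_pos
  positivity

lemma strictMono_bicriticalFun (x t : ℝ) : StrictMono (bicriticalFun x t) := by
  have hdiff : Differentiable ℝ (bicriticalFun x t) := fun y =>
    (hasDerivAt_bicriticalFun x t y).differentiableAt
  have hmono : Monotone (bicriticalFun x t) := by
    refine monotone_of_deriv_nonneg hdiff fun y => ?_
    rw [(hasDerivAt_bicriticalFun x t y).deriv]
    positivity
  refine hmono.strictMono_of_injective fun a b hab => ?_
  by_contra hne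
  wlog hlt : a < b generalizing a b
  · exact this b a hab.symm (Ne.symm hne) (lt_of_le_of_ne (not_lt.1 hlt) (Ne.symm hne))
  have hzero : Ioo a b ⊆ range (fun m : ℤ => (0 : ℝ) + m) ∪ range (fun m : ℤ => x + m) := by
    intro y hy
    have hev : bicriticalFun x t =ᶠ[𝓝 y] fun _ => bicriticalFun x t a := by
      filter_upwards [isOpen_Ioo.mem_nhds hy] with z hz
      exact le_antisymm (hab ▸ hmono hz.2.le) (hmono hz.1.le)
    have hd : deriv (bicriticalFun x t) y = 0 := by
      rw [hev.deriv_eq, deriv_const]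
    rcases (deriv_bicriticalFun_eq_zero_iff x t y).1 hd with ⟨m, hm⟩ | ⟨m, hm⟩
    · exact Or.inl ⟨m, hm.symm⟩
    · exact Or.inr ⟨m, hm.symm⟩
  have hcount := ((countable_range _).union (countable_range _)).mono hzero
  exact absurd hlt (not_lt.2 (Cardinal.Real.Ioo_countable_iff.1 hcount))

/-- `bicriticalFun` as a degree one lift. -/
def bicriticalLift (x t : ℝ) : CircleDeg1Lift where
  toFun := bicriticalFun x t
  monotone' := (strictMono_bicriticalFun x t).monotone
  map_add_one' := bicriticalFun_add_one x t

lemma coe_bicriticalLift (x t : ℝ) : ⇑(bicriticalLift x t) = bicriticalFun x t := rfl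

lemma bijective_bicriticalLift (x t : ℝ) : Function.Bijective (bicriticalLift x t) :=
  ⟨(strictMono_bicriticalFun x t).injective,
    (CircleDeg1Lift.continuous_iff_surjective _).1
      (continuous_bicriticalFun.comp (by fun_prop : Continuous fun y : ℝ => ((x, t), y)))⟩

/-! ### Non-flatness -/

lemma StrictMono.nonFlatAt {F : ℝ → ℝ} {c : ℝ} (hmono : StrictMono F) (hF : AnalyticAt ℝ F c)
    (hc : deriv F c = 0) : NonFlatAt F c := by
  have hF' : AnalyticAt ℝ (fun y => F y - F c) c := hF.sub analyticAt_const
  have htop : ¬ ∀ᶠ y in 𝓝 c, F y - F c = 0 := by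
    intro h
    obtain ⟨y, hy, hne⟩ := ((h.filter_mono nhdsWithin_le_nhds).and
      (self_mem_nhdsWithin : Ioi c ∈ 𝓝[>] c)).exists
    exact (hmono hne).ne' (sub_eq_zero.1 hy)
  obtain ⟨n, u, hu, hu0, hfac⟩ := hF'.exists_eventuallyEq_pow_smul_nonzero_iff.2 htop
  simp only [smul_eq_mul] at hfac
  have hn1 : n ≠ 0 := by
    rintro rfl
    have := hfac.self_of_nhds
    simp only [sub_self, pow_zero, one_mul] at this
    exact hu0 this.symm
  have hpos : 0 < u c := by
    refine lt_of_le_of_ne ?_ hu0.symm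
    refine ge_of_tendsto (hu.continuousAt.tendsto.mono_left
      (nhdsWithin_le_nhds (s := Ioi c))) ?_
    filter_upwards [hfac.filter_mono nhdsWithin_le_nhds, self_mem_nhdsWithin] with y hy hyc
    have h1 : 0 < (y - c) ^ n := pow_pos (sub_pos.2 hyc) n
    have h2 : 0 < (y - c) ^ n * u y := hy ▸ sub_pos.2 (hmono hyc)
    exact (pos_of_mul_pos_right h2 h1.le).le
  have hupos : ∀ᶠ y in 𝓝 c, 0 < u y := hu.continuousAt.eventually (lt_mem_nhds hpos)
  have hodd : Odd n := by
    by_contra heven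
    rw [Nat.not_odd_iff_even] at heven
    obtain ⟨y, ⟨hy, hy'⟩, hyc⟩ := (((hfac.and hupos).filter_mono nhdsWithin_le_nhds).and
      (self_mem_nhdsWithin : Iio c ∈ 𝓝[<] c)).exists
    have h1 : 0 ≤ (y - c) ^ n * u y := mul_nonneg (heven.pow_nonneg _) hy'.le
    linarith [hmono hyc]
  have hn2 : n ≠ 1 := by
    rintro rfl
    have h1 : HasDerivAt (fun y => (y - c) ^ 1 * u y) (u c) c := by
      have := ((hasDerivAt_id' c).sub_const c).fun_mul hu.differentiableAt.hasDerivAt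
      simpa using this
    have h2 : HasDerivAt (fun y => F y - F c) 0 c := by
      simpa [hc] using hF.differentiableAt.hasDerivAt.sub_const (F c)
    exact hu0 (h1.unique (h2.congr_of_eventuallyEq (hfac.mono fun y hy => hy.symm)))
  set v : ℝ → ℝ := fun y => Real.exp (Real.log (u y) / n) with hv
  have hvan : AnalyticAt ℝ v c := ((hu.log hpos).div_const).rexp
  set φ : ℝ → ℝ := fun y => (y - c) * v y with hφ
  have hφan : AnalyticAt ℝ φ c := (analyticAt_id.sub analyticAt_const).mul hvan
  have hφd : deriv φ c ≠ 0 := by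
    have h1 : HasDerivAt φ (v c) c := by
      have := ((hasDerivAt_id' c).sub_const c).fun_mul hvan.differentiableAt.hasDerivAt
      simpa using this
    rw [h1.deriv]
    exact (Real.exp_pos _).ne'
  have hev : ∀ᶠ y in 𝓝 c, AnalyticAt ℝ φ y ∧ deriv φ y ≠ 0 ∧
      F y = F c + φ y * |φ y| ^ ((n : ℝ) - 1) := by
    filter_upwards [hφan.eventually_analyticAt,
      hφan.deriv.continuousAt.eventually_ne hφd, hfac, hupos] with y h1 h2 h3 h4
    refine ⟨h1, h2, ?_⟩
    obtain ⟨l, hl⟩ := hodd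
    have hn' : ((n : ℝ) - 1) = ((2 * l : ℕ) : ℝ) := by
      rw [hl]
      push_cast
      ring
    have h5 : φ y * |φ y| ^ ((n : ℝ) - 1) = φ y ^ n := by
      rw [hn', Real.rpow_natCast, pow_mul, sq_abs, ← pow_mul, hl, pow_succ']
    have h6 : v y ^ n = u y := by
      rw [hv, ← Real.exp_nat_mul, mul_div_cancel₀ _ (Nat.cast_ne_zero.2 hn1), Real.exp_log h4]
    rw [h5, hφ, mul_pow, h6]
    linarith
  obtain ⟨W, hW, hWo, hcW⟩ := eventually_nhds_iff.1 hev
  refine ⟨n, ?_, W, hWo, hcW, φ, ?_, ?_, fun y hy => (hW y hy).2.1, by simp [hφ],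
    fun y hy => (hW y hy).2.2⟩
  · have : 1 < n := by omega
    exact_mod_cast this
  · exact fun y hy => (hW y hy).1.contDiffAt.contDiffWithinAt
  · intro y hy z hz hyz
    refine hmono.injective ?_
    rw [(hW y hy).2.2, (hW z hz).2.2, hyz]

/-! ### Choosing the parameters -/

section Parameters

open CircleDeg1Lift

lemma continuous_bicriticalLift :
    Continuous fun p : (ℝ × ℝ) × ℝ => bicriticalLift p.1.1 p.1.2 p.2 :=
  continuous_bicriticalFun

lemma continuous_translationNumber_bicriticalLift :
    Continuous fun p : ℝ × ℝ => translationNumber (bicriticalLift p.1 p.2) :=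
  CircleDeg1Lift.continuous_translationNumber
    (F := fun p : ℝ × ℝ => bicriticalLift p.1 p.2) continuous_bicriticalLift

lemma exists_translationNumber_bicriticalLift_eq {ρ : ℝ} (hρ : ρ ∈ Icc (0 : ℝ) 1) (x : ℝ) :
    ∃ t ∈ Icc (0 : ℝ) 1, translationNumber (bicriticalLift x t) = ρ := by
  have h0 : translationNumber (bicriticalLift x 0) = 0 := by
    have := translationNumber_of_eq_add_int (bicriticalLift x 0) (x := 0) (m := 0)
      (by simp [coe_bicriticalLift, bicriticalFun_zero])
    simpa using this
  have h1 : translationNumber (bicriticalLift x 1) = 1 := by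
    have := translationNumber_of_eq_add_int (bicriticalLift x 1) (x := 0) (m := 1)
      (by simp [coe_bicriticalLift, bicriticalFun_zero])
    simpa using this
  have hc : Continuous fun t : ℝ => translationNumber (bicriticalLift x t) :=
    Continuous.comp (g := fun p : ℝ × ℝ => translationNumber (bicriticalLift p.1 p.2))
      (f := fun t : ℝ => (x, t)) continuous_translationNumber_bicriticalLift
      (Continuous.prodMk_right x)
  have := intermediate_value_Icc zero_le_one hc.continuousOn
  rw [h0, h1] at this
  exact this hρ

lemma eq_of_translationNumber_bicriticalLift_eq {ρ : ℝ} (hρ : Irrational ρ) {x s t : ℝ}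
    (hs : translationNumber (bicriticalLift x s) = ρ)
    (ht : translationNumber (bicriticalLift x t) = ρ) : s = t := by
  by_contra hne
  wlog hlt : s < t generalizing s t
  · exact this ht hs (Ne.symm hne) (lt_of_le_of_ne (not_lt.1 hlt) (Ne.symm hne))
  refine translationNumber_ne_of_add_le (bijective_bicriticalLift x s) hρ hs (sub_pos.2 hlt)
    (fun y => le_of_eq ?_) ht
  simp only [coe_bicriticalLift, bicriticalFun]
  ring

variable {f h : CircleDeg1Lift} {ρ α x : ℝ}

lemma semiconj_iterate_zero_add_int (h0 : h 0 = 0) (hh : ∀ y, h (f y) = h y + ρ) (m : ℕ) (n : ℤ) :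
    h (f^[m] 0 + n) = m * ρ + n := by
  rw [h.map_add_int, semiconj_iterate_apply hh, h0, zero_add]

/-- The sublevel sets of a semiconjugacy to an irrational translation are described by the orbit
of `0`, that is, by conditions closed in `f`. -/
lemma semiconj_le_iff (hρ : Irrational ρ) (h0 : h 0 = 0) (hh : ∀ y, h (f y) = h y + ρ) :
    h x ≤ α ↔ ∀ (m : ℕ) (n : ℤ), α < m * ρ + n → x ≤ f^[m] 0 + n := by
  constructor
  · intro hx m n hmn
    by_contra! hlt
    have := h.monotone hlt.le
    rw [semiconj_iterate_zero_add_int h0 hh] at this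
    linarith
  · intro H
    by_contra! hlt
    obtain ⟨m, n, h1, h2⟩ := hρ.exists_nat_mul_add_int_mem_Ioo hlt
    have := h.monotone (H m n h1)
    rw [semiconj_iterate_zero_add_int h0 hh] at this
    linarith

lemma le_semiconj_iff (hρ : Irrational ρ) (h0 : h 0 = 0) (hh : ∀ y, h (f y) = h y + ρ) :
    α ≤ h x ↔ ∀ (m : ℕ) (n : ℤ), m * ρ + n < α → f^[m] 0 + n ≤ x := by
  constructor
  · intro hx m n hmn
    by_contra! hlt
    have := h.monotone hlt.le
    rw [semiconj_iterate_zero_add_int h0 hh] at this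
    linarith
  · intro H
    by_contra! hlt
    obtain ⟨m, n, h1, h2⟩ := hρ.exists_nat_mul_add_int_mem_Ioo hlt
    have := h.monotone (H m n h2)
    rw [semiconj_iterate_zero_add_int h0 hh] at this
    linarith

lemma exists_bicriticalLift_semiconj (hρ : Irrational ρ) (hρ01 : ρ ∈ Icc (0 : ℝ) 1)
    (hα : α ∈ Ioo (0 : ℝ) 1) :
    ∃ x ∈ Ioo (0 : ℝ) 1, ∃ t, translationNumber (bicriticalLift x t) = ρ ∧
      ∃ h k : CircleDeg1Lift, h 0 = 0 ∧ h x = α ∧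
        (∀ s, k (s + ρ) = bicriticalLift x t (k s)) ∧ ∀ s, h (k s) = s := by
  let F : ℝ × ℝ → CircleDeg1Lift := fun p => bicriticalLift p.1 p.2
  have hF : ∀ m : ℕ, Continuous fun p => (F p)^[m] 0 :=
    continuous_iterate_zero continuous_bicriticalLift
  let K : Set (ℝ × ℝ) := (Icc 0 1 ×ˢ Icc 0 1) ∩ {p | translationNumber (F p) = ρ}
  have hK : IsCompact K := (isCompact_Icc.prod isCompact_Icc).inter_right
    (isClosed_eq continuous_translationNumber_bicriticalLift continuous_const)
  let A : Set (ℝ × ℝ) := ⋂ (m : ℕ) (n : ℤ) (_ : α < m * ρ + n), {p | p.1 ≤ (F p)^[m] 0 + n}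
  let B : Set (ℝ × ℝ) := ⋂ (m : ℕ) (n : ℤ) (_ : m * ρ + n < α), {p | (F p)^[m] 0 + n ≤ p.1}
  have hA : IsClosed A := isClosed_iInter fun m => isClosed_iInter fun n => isClosed_iInter
    fun _ => isClosed_le continuous_fst ((hF m).add continuous_const)
  have hB : IsClosed B := isClosed_iInter fun m => isClosed_iInter fun n => isClosed_iInter
    fun _ => isClosed_le ((hF m).add continuous_const) continuous_fst
  have hAB : ∀ x ∈ Icc (0 : ℝ) 1, ∃ t, (x, t) ∈ K ∧ ∃ h : CircleDeg1Lift, h 0 = 0 ∧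
      (h x ≤ α ↔ (x, t) ∈ A) ∧ (α ≤ h x ↔ (x, t) ∈ B) := by
    intro x hx
    obtain ⟨t, ht, hτ⟩ := exists_translationNumber_bicriticalLift_eq hρ01 x
    obtain ⟨h, -, h0, hh, -⟩ := exists_semiconj_section (bijective_bicriticalLift x t) hρ hτ
    refine ⟨t, ⟨⟨hx, ht⟩, hτ⟩, h, h0, ?_, ?_⟩
    · simpa [A, F] using semiconj_le_iff hρ h0 hh
    · simpa [B, F] using le_semiconj_iff hρ h0 hh
  have hne : (Icc (0 : ℝ) 1 ∩ (Prod.fst '' (K ∩ A) ∩ Prod.fst '' (K ∩ B))).Nonempty := by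
    refine isPreconnected_closed_iff.1 isPreconnected_Icc _ _
      ((hK.inter_right hA).image continuous_fst).isClosed
      ((hK.inter_right hB).image continuous_fst).isClosed ?_ ?_ ?_
    · intro x hx
      obtain ⟨t, hK, h, -, hA', hB'⟩ := hAB x hx
      rcases le_total (h x) α with hle | hle
      · exact Or.inl ⟨_, ⟨hK, hA'.1 hle⟩, rfl⟩
      · exact Or.inr ⟨_, ⟨hK, hB'.1 hle⟩, rfl⟩
    · obtain ⟨t, hK, h, h0, hA', -⟩ := hAB 0 (left_mem_Icc.2 zero_le_one)
      exact ⟨0, left_mem_Icc.2 zero_le_one, _, ⟨hK, hA'.1 (h0.trans_le hα.1.le)⟩, rfl⟩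
    · obtain ⟨t, hK, h, h0, -, hB'⟩ := hAB 1 (right_mem_Icc.2 zero_le_one)
      have h1 : h 1 = 1 := by simpa [h0] using h.map_add_one 0
      exact ⟨1, right_mem_Icc.2 zero_le_one, _, ⟨hK, hB'.1 (hα.2.le.trans h1.ge)⟩, rfl⟩
  obtain ⟨x, hx, ⟨⟨x₁, t⟩, ⟨⟨-, hτ⟩, htA⟩, hx₁⟩, ⟨⟨x₂, t'⟩, ⟨⟨-, hτ'⟩, htB⟩, hx₂⟩⟩ := hne
  obtain rfl : x₁ = x := hx₁
  obtain rfl : x₂ = x₁ := hx₂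
  obtain rfl := eq_of_translationNumber_bicriticalLift_eq hρ hτ hτ'
  obtain ⟨h, k, h0, hh, hk, hhk⟩ := exists_semiconj_section (bijective_bicriticalLift _ t) hρ hτ
  have h1 : h 1 = 1 := by simpa [h0] using h.map_add_one 0
  have hα' := le_antisymm ((semiconj_le_iff hρ h0 hh).2 (by simpa [A, F] using htA))
    ((le_semiconj_iff hρ h0 hh).2 (by simpa [B, F] using htB))
  refine ⟨_, ⟨lt_of_le_of_ne hx.1 ?_, lt_of_le_of_ne hx.2 ?_⟩, t, hτ, h, k, h0, hα', hk, hhk⟩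
  · intro he
    rw [← he, h0] at hα'
    exact hα.1.ne hα'
  · intro he
    rw [he, h1] at hα'
    exact hα.2.ne' hα'

end Parameters

/-! ### The invariant measure -/

section InvariantMeasure

/-- The self-map of the circle induced by a degree one lift. -/
def CircleDeg1Lift.circleMap (f : CircleDeg1Lift) : S1 → S1 :=
  Function.Periodic.lift (f := fun y : ℝ => (f y : S1)) (c := (1 : ℝ)) fun y => by
    simp only [f.map_add_one, AddCircle.coe_add_period]

lemma CircleDeg1Lift.circleMap_coe (f : CircleDeg1Lift) (y : ℝ) :
    f.circleMap (y : S1) = (f y : S1) := rfl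

lemma CircleDeg1Lift.measurable_circleMap (f : CircleDeg1Lift) : Measurable f.circleMap := by
  have h : f.circleMap =
      fun z => ((f (AddCircle.measurableEquivIco (1 : ℝ) 0 z : ℝ) : ℝ) : S1) := by
    funext z
    rw [← f.circleMap_coe]
    congr 1
    exact AddCircle.coe_equivIco.symm
  rw [h]
  exact AddCircle.measurable_mk'.comp (f.monotone.measurable.comp
    (measurable_subtype_coe.comp (AddCircle.measurableEquivIco (1 : ℝ) 0).measurable))

lemma isLift_circleMap {f : CircleDeg1Lift} (hf : Function.Bijective f) : IsLift f.circleMap f :=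
  ⟨f.strictMono_iff_injective.2 hf.1, hf.2, f.map_add_one, f.circleMap_coe⟩

variable {x : ℝ}

lemma posArc_zero_coe (hx : x ∈ Ioo (0 : ℝ) 1) :
    posArc (0 : S1) (x : S1) = (fun t : ℝ => (t : S1)) '' Ioo 0 x := by
  have h : arcLen (0 : S1) (x : S1) = x := by
    rw [arcLen, sub_zero, AddCircle.equivIco_coe_eq (by simpa using ⟨hx.1.le, hx.2⟩)]
  simp only [posArc, h, zero_add]

lemma posArc_coe_zero (hx : x ∈ Ioo (0 : ℝ) 1) :
    posArc (x : S1) (0 : S1) = (fun t : ℝ => (t : S1)) '' Ioo x 1 := by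
  have h : arcLen (x : S1) (0 : S1) = 1 - x := by
    have h1 : (0 : S1) - (x : S1) = ((1 - x : ℝ) : S1) := by
      rw [AddCircle.coe_sub, AddCircle.coe_period]
    rw [arcLen, h1, AddCircle.equivIco_coe_eq (by
      constructor <;> linarith [hx.1, hx.2])]
  have h2 : Ioo x 1 = (fun t => x + t) '' Ioo 0 (1 - x) := by
    rw [image_const_add_Ioo]
    simp
  rw [posArc, h, h2, image_image]
  simp only [AddCircle.coe_add]

lemma disjoint_posArc (hx : x ∈ Ioo (0 : ℝ) 1) :
    Disjoint (posArc (0 : S1) (x : S1)) (posArc (x : S1) (0 : S1)) := by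
  rw [posArc_zero_coe hx, posArc_coe_zero hx, Set.disjoint_left]
  rintro _ ⟨s, hs, rfl⟩ ⟨t, ht, hst⟩
  have := (AddCircle.coe_eq_coe_iff_of_mem_Ico (p := (1 : ℝ)) (a := 0) (x := t) (y := s)
    ⟨by linarith [ht.1, hx.1], by linarith [ht.2]⟩
    ⟨hs.1.le, by linarith [hs.2, hx.2]⟩).1 hst
  linarith [hs.2, ht.1]

lemma ofReal_le_map_circleMap_image {h k : CircleDeg1Lift} (hhk : ∀ s, h (k s) = s) {a b : ℝ}
    (ha : 0 ≤ h a) (hb : h b ≤ 1) :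
    ENNReal.ofReal (h b - h a) ≤
      (volume : Measure S1).map k.circleMap ((fun t : ℝ => (t : S1)) '' Ioo a b) := by
  have ho : IsOpen ((fun t : ℝ => (t : S1)) '' Ioo a b) :=
    QuotientAddGroup.isOpenMap_coe _ isOpen_Ioo
  have hm := k.measurable_circleMap ho.measurableSet
  rw [Measure.map_apply k.measurable_circleMap ho.measurableSet,
    AddCircle.add_projection_respects_measure (1 : ℝ) 0 hm, ← Real.volume_Ioo]
  refine measure_mono fun s hs => ⟨⟨k s, ⟨?_, ?_⟩, rfl⟩, ?_, ?_⟩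
  · by_contra! hle
    have := h.monotone hle
    rw [hhk] at this
    exact absurd hs.1 (not_lt.2 this)
  · by_contra! hle
    have := h.monotone hle
    rw [hhk] at this
    exact absurd hs.2 (not_lt.2 this)
  · exact ha.trans_lt hs.1
  · linarith [hs.2]

end InvariantMeasure

lemma admissible_of_irrational {ρ α : ℝ} (hρ : Irrational ρ) (hρ01 : ρ ∈ Icc (0 : ℝ) 1)
    (hα : α ∈ Ioo (0 : ℝ) 1) : Admissible ρ α := by
  obtain ⟨x, hx, t, hτ, h, k, h0, hhx, hk, hhk⟩ := exists_bicriticalLift_semiconj hρ hρ01 hα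
  have h1 : h 1 = 1 := by simpa [h0] using h.map_add_one 0
  set f := bicriticalLift x t
  have hlift : IsLift f.circleMap f := isLift_circleMap (bijective_bicriticalLift x t)
  have hkm := k.measurable_circleMap
  set μ : Measure S1 := volume.map k.circleMap with hμ
  have hprob : IsProbabilityMeasure (volume : Measure S1) := ⟨UnitAddCircle.measure_univ⟩
  have hμprob : IsProbabilityMeasure μ := Measure.isProbabilityMeasure_map hkm.aemeasurable
  have hinv : μ.map f.circleMap = μ := by
    have hcomp : f.circleMap ∘ k.circleMap = k.circleMap ∘ fun z => z + (ρ : S1) := by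
      funext z
      induction z using QuotientAddGroup.induction_on with
      | H s =>
        exact congrArg (fun y : ℝ => (y : S1)) (hk s).symm
    rw [hμ, Measure.map_map f.measurable_circleMap hkm, hcomp,
      ← Measure.map_map hkm (measurable_add_const _), map_add_right_eq_self]
  have hA : ENNReal.ofReal α ≤ μ (posArc (0 : S1) (x : S1)) := by
    have := ofReal_le_map_circleMap_image hhk (a := 0) (b := x) h0.ge (hhx.trans_le hα.2.le)
    rwa [h0, hhx, sub_zero, ← posArc_zero_coe hx] at this
  have hB : ENNReal.ofReal (1 - α) ≤ μ (posArc (x : S1) (0 : S1)) := by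
    have := ofReal_le_map_circleMap_image hhk (a := x) (b := 1) (hα.1.le.trans hhx.ge) h1.le
    rwa [h1, hhx, ← posArc_coe_zero hx] at this
  have hBm : MeasurableSet (posArc (x : S1) (0 : S1)) := by
    rw [posArc_coe_zero hx]
    exact (QuotientAddGroup.isOpenMap_coe _ isOpen_Ioo).measurableSet
  have hsum : μ.real (posArc (0 : S1) (x : S1)) + μ.real (posArc (x : S1) (0 : S1)) ≤ 1 := by
    rw [← measureReal_union (disjoint_posArc hx) hBm]
    exact measureReal_le_one
  have hA' : α ≤ μ.real (posArc (0 : S1) (x : S1)) :=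
    (ENNReal.ofReal_le_iff_le_toReal (measure_ne_top _ _)).1 hA
  have hB' : 1 - α ≤ μ.real (posArc (x : S1) (0 : S1)) :=
    (ENNReal.ofReal_le_iff_le_toReal (measure_ne_top _ _)).1 hB
  have hcrit : {y : ℝ | deriv f y = 0} =
      {y : ℝ | ∃ m : ℤ, y = 0 + m} ∪ {y : ℝ | ∃ m : ℤ, y = x + m} := by
    ext y
    exact deriv_bicriticalFun_eq_zero_iff x t y
  have hflat : ∀ c, deriv f c = 0 → NonFlatAt f c := fun c hc =>
    (strictMono_bicriticalFun x t).nonFlatAt (analyticAt_bicriticalFun x t c) hc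
  refine ⟨f.circleMap, (0 : S1), (x : S1), μ, ⟨?_, f, 0, x, hlift, ?_, rfl, rfl, hcrit,
    hflat 0 ?_, hflat x ?_⟩, ⟨f, hlift, ?_⟩, hμprob, hinv, ?_, ?_⟩
  · intro he
    have := (AddCircle.coe_eq_coe_iff_of_mem_Ico (p := (1 : ℝ)) (a := 0) (x := 0) (y := x)
      (by simp) (by simpa using ⟨hx.1.le, hx.2⟩)).1 he
    exact hx.1.ne this
  · exact contDiff_iff_contDiffAt.2 fun y => (analyticAt_bicriticalFun x t y).contDiffAt
  · exact (deriv_bicriticalFun_eq_zero_iff x t 0).2 (Or.inl ⟨0, by simp⟩)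
  · exact (deriv_bicriticalFun_eq_zero_iff x t x).2 (Or.inr ⟨0, by simp⟩)
  · simpa [CircleDeg1Lift.coe_pow, hτ] using f.tendsto_translation_number₀
  · change μ.real _ = α
    linarith
  · change μ.real _ = 1 - α
    linarith

/-- **Lemma 7.5.** If `ρ₀ ∈ (0, 1/8)` is irrational, then every pair `(ρ₀, α)` with
`α ∈ [2ρ₀, 3ρ₀]` is admissible. -/
theorem admissibleInterval (ρ₀ : ℝ) (hρ₀ : ρ₀ ∈ Ioo (0 : ℝ) (1 / 8)) (hirr : Irrational ρ₀) :
    ∀ α ∈ Icc (2 * ρ₀) (3 * ρ₀), Admissible ρ₀ α := by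
  intro α hα
  refine admissible_of_irrational hirr ⟨hρ₀.1.le, ?_⟩ ⟨?_, ?_⟩ <;>
    linarith [hρ₀.1, hρ₀.2, hα.1, hα.2]
end
end
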